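/- arXiv:1407.0988 — 3 statements merged into one kernel-verified Lean document; each statement's English description precedes it below -/
import Mathlib

section
/- Let n ≥ 1, k ≥ 1 be integers and 1 ≤ p < ∞ a real number with kp > n, and let δ ∈ ℝ. Then there exists a constant C > 0 (depending only on n, k, p, δ) such that for every k-times continuously differentiable function u : ℝⁿ \ {0} → ℝ and every x ∈ ℝⁿ \ {0}, one has ‖x‖^{-δ}·|u(x)| ≤ C · Σ_{j=0}^{k} ( ∫_{ℝⁿ\{0}} ‖D^j u(y)‖^p · ‖y‖^{-(δ-j)p-n} dy )^{1/p}, where D^j u denotes the j-th (iterated Fréchet) derivative of u and the inequality is interpreted as trivially true when the right-hand side is infinite. -/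
open MeasureTheory

theorem wse_taylor {n m : ℕ} {u : EuclideanSpace ℝ (Fin n) → ℝ}
    (hu : ContDiffOn ℝ (m + 1 : ℕ) u {0}ᶜ) {x w : EuclideanSpace ℝ (Fin n)}
    (hw : ‖w‖ < ‖x‖) :
    ENNReal.ofReal |u x| ≤ ∑ j ∈ Finset.range (m + 1),
      ENNReal.ofReal (‖iteratedFDerivWithin ℝ j u {0}ᶜ (x + w)‖ * ‖w‖ ^ j) +
      ∫⁻ s in Set.Ioc (0:ℝ) 1, ENNReal.ofReal (s ^ m *
        (‖iteratedFDerivWithin ℝ (m + 1) u {0}ᶜ (x + s • w)‖ * ‖w‖ ^ (m + 1))) := by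
  have hne : ∀ s ∈ Set.Icc (0:ℝ) 1, x + s • w ∈ ({0}ᶜ : Set (EuclideanSpace ℝ (Fin n))) := by
    intro s hs h0
    have h1 : x = -(s • w) := eq_neg_of_add_eq_zero_left h0
    have h2 : ‖x‖ = s * ‖w‖ := by
      rw [h1, norm_neg, norm_smul, Real.norm_of_nonneg hs.1]
    nlinarith [norm_nonneg w, hs.2]
  have hopen : IsOpen ({0}ᶜ : Set (EuclideanSpace ℝ (Fin n))) := isOpen_compl_singleton
  have hg : ∀ j, ∀ z ∈ ({0}ᶜ : Set (EuclideanSpace ℝ (Fin n))),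
      iteratedFDeriv ℝ j u z = iteratedFDerivWithin ℝ j u {0}ᶜ z := fun j z hz =>
    (iteratedFDerivWithin_of_isOpen j hopen hz).symm
  have hpt : ∀ t : ℝ, x + w + t • (-w) = x + (1 - t) • w := by
    intro t; module
  have key := map_add_eq_sum_add_integral_iteratedFDeriv (f := u) (x := x + w) (y := -w) (n := m)
    (by
      intro t ht
      rw [hpt]
      exact (hu.contDiffAt (hopen.mem_nhds (hne (1 - t) ⟨by linarith [ht.2], by linarith [ht.1]⟩))))
  rw [add_neg_cancel_right] at key
  have hbd : ∀ j, ∀ z ∈ ({0}ᶜ : Set (EuclideanSpace ℝ (Fin n))),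
      |iteratedFDeriv ℝ j u z (fun _ => -w)| ≤ ‖iteratedFDerivWithin ℝ j u {0}ᶜ z‖ * ‖w‖ ^ j := by
    intro j z hz
    have := (iteratedFDeriv ℝ j u z).le_opNorm (fun _ => -w)
    simpa [hg j z hz] using this
  have hfac : ∀ j : ℕ, ((j.factorial : ℝ))⁻¹ ≤ 1 := fun j =>
    inv_le_one_of_one_le₀ (by exact_mod_cast Nat.one_le_iff_ne_zero.2 j.factorial_ne_zero)
  have hfac0 : ∀ j : ℕ, 0 ≤ ((j.factorial : ℝ))⁻¹ := fun j => by positivity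
  have hsum : |∑ k ∈ Finset.range (m + 1), ((k.factorial : ℝ))⁻¹ •
      (iteratedFDeriv ℝ k u (x + w) fun _ => -w)| ≤ ∑ j ∈ Finset.range (m + 1),
      ‖iteratedFDerivWithin ℝ j u {0}ᶜ (x + w)‖ * ‖w‖ ^ j := by
    refine (Finset.abs_sum_le_sum_abs _ _).trans (Finset.sum_le_sum fun j _ => ?_)
    rw [smul_eq_mul, abs_mul, abs_of_nonneg (hfac0 j)]
    have h1 := hbd j (x + w) (by simpa using hne 1 (by simp))
    nlinarith [hfac j, abs_nonneg (iteratedFDeriv ℝ j u (x + w) fun _ => -w)]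
  have hint : (∫ t in (0:ℝ)..1, (1 - t) ^ m • (iteratedFDeriv ℝ (m + 1) u (x + w + t • (-w)))
        (fun _ => -w)) = ∫ s in (0:ℝ)..1, s ^ m • (iteratedFDeriv ℝ (m + 1) u (x + s • w))
        (fun _ => -w) := by
    simp_rw [hpt]
    rw [intervalIntegral.integral_comp_sub_left (fun s => s ^ m •
      (iteratedFDeriv ℝ (m + 1) u (x + s • w)) (fun _ => -w)) 1]
    simp
  have hint2 : ENNReal.ofReal |∫ s in (0:ℝ)..1, s ^ m • (iteratedFDeriv ℝ (m + 1) u (x + s • w))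
        (fun _ => -w)| ≤ ∫⁻ s in Set.Ioc (0:ℝ) 1, ENNReal.ofReal (s ^ m *
        (‖iteratedFDerivWithin ℝ (m + 1) u {0}ᶜ (x + s • w)‖ * ‖w‖ ^ (m + 1))) := by
    rw [intervalIntegral.integral_of_le zero_le_one, ← Real.enorm_eq_ofReal_abs]
    refine (enorm_integral_le_lintegral_enorm _).trans ?_
    refine setLIntegral_mono' measurableSet_Ioc fun s hs => ?_
    rw [Real.enorm_eq_ofReal_abs]
    refine ENNReal.ofReal_le_ofReal ?_
    rw [smul_eq_mul, abs_mul, abs_of_nonneg (pow_nonneg hs.1.le m)]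
    exact mul_le_mul_of_nonneg_left (hbd _ _ (hne s ⟨hs.1.le, hs.2⟩)) (pow_nonneg hs.1.le m)
  rw [hint] at key
  have habs : |u x| ≤ (∑ j ∈ Finset.range (m + 1),
      ‖iteratedFDerivWithin ℝ j u {0}ᶜ (x + w)‖ * ‖w‖ ^ j) +
      |∫ s in (0:ℝ)..1, s ^ m • (iteratedFDeriv ℝ (m + 1) u (x + s • w)) (fun _ => -w)| := by
    rw [key]
    refine (abs_add_le _ _).trans (add_le_add hsum ?_)
    rw [smul_eq_mul, abs_mul, abs_of_nonneg (hfac0 m)]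
    exact mul_le_of_le_one_left (abs_nonneg _) (hfac m)
  refine (ENNReal.ofReal_le_ofReal habs).trans ?_
  rw [ENNReal.ofReal_add (Finset.sum_nonneg fun j _ => by positivity) (abs_nonneg _),
    ENNReal.ofReal_sum_of_nonneg (fun j _ => by positivity)]
  exact add_le_add le_rfl hint2

theorem wse_rpow {a r t : ℝ} (hr : 0 < r) (h1 : r / 2 ≤ t) (h2 : t ≤ 2 * r) :
    r ^ a ≤ 2 ^ |a| * t ^ a := by
  have ht : 0 < t := by linarith
  rcases le_total 0 a with ha | ha
  · rw [abs_of_nonneg ha, ← Real.mul_rpow (by norm_num) ht.le]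
    exact Real.rpow_le_rpow hr.le (by linarith) ha
  · rw [abs_of_nonpos ha, Real.rpow_neg (by norm_num), ← Real.inv_rpow (by norm_num),
      ← Real.mul_rpow (by norm_num) ht.le]
    exact Real.rpow_le_rpow_of_nonpos (by positivity) (by linarith) ha

theorem wse_scaled {n m : ℕ} {δ : ℝ} {u : EuclideanSpace ℝ (Fin n) → ℝ}
    (hu : ContDiffOn ℝ (m + 1 : ℕ) u {0}ᶜ) {x v : EuclideanSpace ℝ (Fin n)}
    (hx : x ≠ 0) (hv : ‖v‖ ≤ 1 / 2) (N : ℕ → EuclideanSpace ℝ (Fin n) → ENNReal)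
    (hN : ∀ j z, N j z = ENNReal.ofReal
      (‖iteratedFDerivWithin ℝ j u {0}ᶜ z‖ * ‖z‖ ^ ((j:ℝ) - δ))) :
    ENNReal.ofReal (‖x‖ ^ (-δ) * |u x|) ≤ ENNReal.ofReal (2 ^ ((m:ℝ) + 1 + |δ|)) *
      (∑ j ∈ Finset.range (m + 1), N j (x + ‖x‖ • v) +
      ∫⁻ s in Set.Ioc (0:ℝ) 1, ENNReal.ofReal (s ^ m) * N (m + 1) (x + (s * ‖x‖) • v)) := by
  have hx0 : 0 < ‖x‖ := norm_pos_iff.2 hx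
  have hwn : ‖‖x‖ • v‖ ≤ ‖x‖ / 2 := by
    rw [norm_smul, norm_norm]; nlinarith
  have hz : ∀ s ∈ Set.Icc (0:ℝ) 1, ‖x‖ / 2 ≤ ‖x + s • ‖x‖ • v‖ ∧ ‖x + s • ‖x‖ • v‖ ≤ 2 * ‖x‖ := by
    intro s hs
    have h1 : ‖s • ‖x‖ • v‖ ≤ ‖x‖ / 2 := by
      rw [norm_smul, Real.norm_of_nonneg hs.1]
      nlinarith [norm_nonneg (‖x‖ • v), hs.2]
    constructor
    · have := norm_sub_norm_le x (-(s • ‖x‖ • v))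
      rw [norm_neg, sub_neg_eq_add] at this
      linarith
    · have := norm_add_le x (s • ‖x‖ • v)
      linarith
  have hcmp : ∀ j : ℕ, j ≤ m + 1 → ∀ s ∈ Set.Icc (0:ℝ) 1,
      ENNReal.ofReal (‖x‖ ^ (-δ)) * ENNReal.ofReal
        (‖iteratedFDerivWithin ℝ j u {0}ᶜ (x + s • ‖x‖ • v)‖ * ‖‖x‖ • v‖ ^ j) ≤
      ENNReal.ofReal (2 ^ ((m:ℝ) + 1 + |δ|)) * N j (x + s • ‖x‖ • v) := by
    intro j hj s hs
    rw [hN, ← ENNReal.ofReal_mul (by positivity), ← ENNReal.ofReal_mul (by positivity)]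
    refine ENNReal.ofReal_le_ofReal ?_
    obtain ⟨h1, h2⟩ := hz s hs
    have h3 := wse_rpow (a := (j:ℝ) - δ) hx0 h1 h2
    have h4 : (2:ℝ) ^ |(j:ℝ) - δ| ≤ 2 ^ ((m:ℝ) + 1 + |δ|) := by
      refine Real.rpow_le_rpow_of_exponent_le (by norm_num) ?_
      have := abs_sub (j:ℝ) δ
      rw [Nat.abs_cast] at this
      have hj' : (j:ℝ) ≤ m + 1 := by exact_mod_cast hj
      linarith
    have h5 : ‖‖x‖ • v‖ ^ j ≤ ‖x‖ ^ j := pow_le_pow_left₀ (norm_nonneg _) (by linarith) j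
    have h6 : ‖x‖ ^ (-δ) * ‖x‖ ^ j = ‖x‖ ^ ((j:ℝ) - δ) := by
      rw [← Real.rpow_natCast, ← Real.rpow_add hx0]; congr 1; ring
    set g := ‖iteratedFDerivWithin ℝ j u {0}ᶜ (x + s • ‖x‖ • v)‖
    have hg : 0 ≤ g := norm_nonneg _
    calc ‖x‖ ^ (-δ) * (g * ‖‖x‖ • v‖ ^ j) ≤ ‖x‖ ^ (-δ) * (g * ‖x‖ ^ j) := by gcongr
      _ = g * ‖x‖ ^ ((j:ℝ) - δ) := by rw [← h6]; ring
      _ ≤ g * (2 ^ |(j:ℝ) - δ| * ‖x + s • ‖x‖ • v‖ ^ ((j:ℝ) - δ)) := by gcongr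
      _ ≤ g * (2 ^ ((m:ℝ) + 1 + |δ|) * ‖x + s • ‖x‖ • v‖ ^ ((j:ℝ) - δ)) := by gcongr
      _ = _ := by ring
  rw [ENNReal.ofReal_mul (by positivity)]
  refine (mul_le_mul_right (wse_taylor hu (x := x) (w := ‖x‖ • v) (by linarith)) _).trans ?_
  rw [mul_add, mul_add, Finset.mul_sum, Finset.mul_sum]
  refine add_le_add (Finset.sum_le_sum fun j hj => ?_) ?_
  · have := hcmp j (Finset.mem_range.1 hj).le 1 (by simp)
    simpa using this
  · rw [← lintegral_const_mul' _ _ ENNReal.ofReal_ne_top,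
      ← lintegral_const_mul' _ _ ENNReal.ofReal_ne_top]
    refine setLIntegral_mono' measurableSet_Ioc fun s hs => ?_
    have := hcmp (m + 1) le_rfl s ⟨hs.1.le, hs.2⟩
    rw [ENNReal.ofReal_mul (pow_nonneg hs.1.le m), mul_left_comm, mul_left_comm _ (ENNReal.ofReal (s ^ m)),
      mul_smul]
    exact mul_le_mul_right this _

theorem wse_cov {n : ℕ} {x : EuclideanSpace ℝ (Fin n)} (hx : x ≠ 0) {s : ℝ} (hs : 0 < s)
    (hs1 : s ≤ 1) {G : EuclideanSpace ℝ (Fin n) → ENNReal} (hG : Measurable G) :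
    ∫⁻ v in Metric.ball (0 : EuclideanSpace ℝ (Fin n)) (1 / 2), G (x + (s * ‖x‖) • v) ≤
      ENNReal.ofReal (s ^ (-(n:ℝ)) * 2 ^ (n:ℝ)) *
        ∫⁻ y in ({0}ᶜ : Set (EuclideanSpace ℝ (Fin n))), G y * ENNReal.ofReal (‖y‖ ^ (-(n:ℝ))) := by
  have hx0 : 0 < ‖x‖ := norm_pos_iff.2 hx
  have hr : 0 < s * ‖x‖ := mul_pos hs hx0
  set H : EuclideanSpace ℝ (Fin n) → ENNReal := ({0}ᶜ : Set (EuclideanSpace ℝ (Fin n))).indicator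
    (fun y => G y * ENNReal.ofReal (‖y‖ ^ (-(n:ℝ)))) with hH
  have hHm : Measurable H := by
    refine Measurable.indicator ?_ (measurableSet_singleton _).compl
    exact hG.mul (by fun_prop)
  rw [← lintegral_indicator (measurableSet_singleton _).compl, ← hH]
  have hpt : ∀ v ∈ Metric.ball (0 : EuclideanSpace ℝ (Fin n)) (1 / 2),
      G (x + (s * ‖x‖) • v) ≤ ENNReal.ofReal ((2 * ‖x‖) ^ (n:ℝ)) * H (x + (s * ‖x‖) • v) := by
    intro v hv
    rw [mem_ball_zero_iff] at hv
    have h1 : ‖(s * ‖x‖) • v‖ ≤ ‖x‖ / 2 := by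
      rw [norm_smul, Real.norm_of_nonneg hr.le]
      have : s * ‖x‖ ≤ ‖x‖ := by nlinarith
      nlinarith [norm_nonneg v]
    have h2 := norm_sub_norm_le x (-((s * ‖x‖) • v))
    rw [norm_neg, sub_neg_eq_add] at h2
    have h3 := norm_add_le x ((s * ‖x‖) • v)
    have hz : 0 < ‖x + (s * ‖x‖) • v‖ := by linarith
    rw [hH, Set.indicator_of_mem (by simpa using norm_pos_iff.1 hz)]
    rw [mul_left_comm, ← ENNReal.ofReal_mul (by positivity)]
    refine le_mul_of_one_le_right' ?_
    rw [ENNReal.one_le_ofReal, Real.rpow_neg hz.le, ← div_eq_mul_inv, one_le_div (by positivity)]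
    exact Real.rpow_le_rpow hz.le (by linarith) (by positivity)
  have hmap : ∫⁻ v, H (x + (s * ‖x‖) • v) = ENNReal.ofReal ((s * ‖x‖) ^ (-(n:ℝ))) * ∫⁻ y, H y := by
    have h1 : ∫⁻ v, H (x + (s * ‖x‖) • v) =
        ∫⁻ w, H (x + w) ∂(Measure.map (fun v : EuclideanSpace ℝ (Fin n) => (s * ‖x‖) • v) volume) := by
      rw [lintegral_map (by fun_prop) (by fun_prop)]
    rw [h1]
    have h2 := Measure.map_addHaar_smul (volume : Measure (EuclideanSpace ℝ (Fin n))) hr.ne'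
    rw [show (fun v : EuclideanSpace ℝ (Fin n) => (s * ‖x‖) • v) = ((s * ‖x‖) • ·) from rfl, h2,
      lintegral_smul_measure, lintegral_add_left_eq_self, finrank_euclideanSpace_fin, smul_eq_mul,
      abs_of_nonneg (by positivity), Real.rpow_neg hr.le, Real.rpow_natCast]
  calc _ ≤ ∫⁻ v in Metric.ball (0 : EuclideanSpace ℝ (Fin n)) (1 / 2),
        ENNReal.ofReal ((2 * ‖x‖) ^ (n:ℝ)) * H (x + (s * ‖x‖) • v) :=
        setLIntegral_mono' measurableSet_ball hpt
    _ ≤ ∫⁻ v, ENNReal.ofReal ((2 * ‖x‖) ^ (n:ℝ)) * H (x + (s * ‖x‖) • v) := setLIntegral_le_lintegral _ _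
    _ = ENNReal.ofReal ((2 * ‖x‖) ^ (n:ℝ)) * ∫⁻ v, H (x + (s * ‖x‖) • v) :=
        lintegral_const_mul' _ _ ENNReal.ofReal_ne_top
    _ = _ := by
        rw [hmap, ← mul_assoc, ← ENNReal.ofReal_mul (by positivity)]
        congr 2
        rw [Real.mul_rpow (by norm_num) hx0.le, Real.mul_rpow hs.le hx0.le, Real.rpow_neg hx0.le]
        field_simp

theorem wse_holder {n : ℕ} {p : ℝ} (hp : 1 ≤ p) {x : EuclideanSpace ℝ (Fin n)} (hx : x ≠ 0) {s : ℝ}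
    (hs : 0 < s)
    (hs1 : s ≤ 1) {G : EuclideanSpace ℝ (Fin n) → ENNReal} (hG : Measurable G) :
    ∫⁻ v in Metric.ball (0 : EuclideanSpace ℝ (Fin n)) (1 / 2), G (x + (s * ‖x‖) • v) ≤
      (ENNReal.ofReal (2 ^ (n:ℝ)) ^ (1 / p) *
        volume (Metric.ball (0 : EuclideanSpace ℝ (Fin n)) (1 / 2)) ^ (1 - 1 / p)) *
      (ENNReal.ofReal (s ^ (-(n:ℝ) / p)) *
      (∫⁻ y in ({0}ᶜ : Set (EuclideanSpace ℝ (Fin n))),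
        (G y) ^ p * ENNReal.ofReal (‖y‖ ^ (-(n:ℝ)))) ^ (1 / p)) := by
  have hp0 : 0 < p := by linarith
  have h1 := eLpNorm'_le_eLpNorm'_mul_rpow_measure_univ (p := 1) (q := p) one_pos hp
    (μ := volume.restrict (Metric.ball (0 : EuclideanSpace ℝ (Fin n)) (1 / 2)))
    (f := fun v => G (x + (s * ‖x‖) • v))
    (Measurable.aestronglyMeasurable (by fun_prop))
  simp only [eLpNorm', enorm_eq_self, ENNReal.rpow_one, div_one, Measure.restrict_apply_univ] at h1
  refine h1.trans ?_
  have h2 := wse_cov hx hs hs1 (hG.pow_const p)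
  have h3 := ENNReal.rpow_le_rpow h2 (z := 1 / p) (by positivity)
  refine (mul_le_mul_left h3 _).trans (le_of_eq ?_)
  rw [ENNReal.mul_rpow_of_nonneg _ _ (by positivity), ENNReal.ofReal_mul (by positivity),
    ENNReal.mul_rpow_of_nonneg _ _ (by positivity),
    ENNReal.ofReal_rpow_of_pos (x := s ^ (-(n:ℝ))) (by positivity),
    ← Real.rpow_mul hs.le, mul_one_div]
  ring

theorem weighted_sobolev_embedding (n k : ℕ) (hn : 1 ≤ n) (hk : 1 ≤ k)
    (p δ : ℝ) (hp1 : 1 ≤ p) (hkp : (n : ℝ) < (k : ℝ) * p) :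
    ∃ C : ℝ, 0 < C ∧
      ∀ u : EuclideanSpace ℝ (Fin n) → ℝ, ContDiffOn ℝ k u {0}ᶜ →
        ∀ x : EuclideanSpace ℝ (Fin n), x ≠ 0 →
          ENNReal.ofReal (‖x‖ ^ (-δ) * |u x|) ≤
            ENNReal.ofReal C *
              ∑ j ∈ Finset.range (k + 1),
                (∫⁻ y in ({0}ᶜ : Set (EuclideanSpace ℝ (Fin n))),
                    ENNReal.ofReal
                      (‖iteratedFDerivWithin ℝ j u ({0}ᶜ : Set (EuclideanSpace ℝ (Fin n))) y‖ ^ p *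
                        ‖y‖ ^ (-(δ - (j : ℝ)) * p - (n : ℝ)))) ^ (1 / p) := by
  obtain ⟨m, rfl⟩ : ∃ m, k = m + 1 := ⟨k - 1, by omega⟩
  have hp0 : 0 < p := by linarith
  set V := volume (Metric.ball (0 : EuclideanSpace ℝ (Fin n)) (1 / 2)) with hV
  have hV0 : V ≠ 0 := (Metric.measure_ball_pos _ _ (by norm_num)).ne'
  have hVt : V ≠ ⊤ := measure_ball_lt_top.ne
  set A := ENNReal.ofReal (2 ^ (n:ℝ)) ^ (1 / p) * V ^ (1 - 1 / p) with hA
  have hAt : A ≠ ⊤ := by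
    refine ENNReal.mul_ne_top (ENNReal.rpow_ne_top_of_nonneg (by positivity) ENNReal.ofReal_ne_top)
      (ENNReal.rpow_ne_top_of_nonneg ?_ hVt)
    rw [sub_nonneg, div_le_one hp0]; exact hp1
  set T := ∫⁻ s in Set.Ioc (0:ℝ) 1, ENNReal.ofReal (s ^ m) * ENNReal.ofReal (s ^ (-(n:ℝ) / p)) with hT
  have hTt : T ≠ ⊤ := by
    have h1 : T = ∫⁻ s in Set.Ioc (0:ℝ) 1, ENNReal.ofReal (s ^ ((m:ℝ) + -(n:ℝ) / p)) := by
      refine setLIntegral_congr_fun measurableSet_Ioc fun s hs => ?_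
      rw [← ENNReal.ofReal_mul (pow_nonneg hs.1.le m), Real.rpow_add hs.1, Real.rpow_natCast]
    have h2 : IntervalIntegrable (fun s : ℝ => s ^ ((m:ℝ) + -(n:ℝ) / p)) volume 0 1 := by
      refine intervalIntegral.intervalIntegrable_rpow' ?_
      have : (n:ℝ) / p < m + 1 := by
        rw [div_lt_iff₀ hp0]; exact_mod_cast hkp
      rw [neg_div]; linarith
    rw [intervalIntegrable_iff_integrableOn_Ioc_of_le zero_le_one] at h2
    rw [h1]
    exact h2.lintegral_lt_top.ne
  set K := ENNReal.ofReal (2 ^ ((m:ℝ) + 1 + |δ|)) with hK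
  set D := V⁻¹ * (K * (A * (1 + T))) with hD
  have hDt : D ≠ ⊤ := ENNReal.mul_ne_top (ENNReal.inv_ne_top.2 hV0)
    (ENNReal.mul_ne_top ENNReal.ofReal_ne_top (ENNReal.mul_ne_top hAt
      (ENNReal.add_ne_top.2 ⟨ENNReal.one_ne_top, hTt⟩)))
  refine ⟨D.toReal + 1, by positivity, fun u hu x hx => ?_⟩
  have hDC : D ≤ ENNReal.ofReal (D.toReal + 1) := by
    rw [← ENNReal.ofReal_toReal hDt]
    exact ENNReal.ofReal_le_ofReal (by simp)
  refine le_trans ?_ (mul_le_mul_left hDC _)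
  set N : ℕ → EuclideanSpace ℝ (Fin n) → ENNReal := fun j z => ENNReal.ofReal
      (‖iteratedFDerivWithin ℝ j u {0}ᶜ z‖ * ‖z‖ ^ ((j:ℝ) - δ)) with hN
  have hNm : ∀ j ≤ m + 1, Measurable (N j) := by
    intro j hj
    have h1 : ContinuousOn (iteratedFDerivWithin ℝ j u {0}ᶜ) {0}ᶜ :=
      hu.continuousOn_iteratedFDerivWithin (by exact_mod_cast hj)
        isOpen_compl_singleton.uniqueDiffOn
    have h2 : Measurable fun z => ‖iteratedFDerivWithin ℝ j u {0}ᶜ z‖ :=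
      measurable_of_continuousOn_compl_singleton 0 h1.norm
    exact (h2.mul (by fun_prop)).ennreal_ofReal
  set I : ℕ → ENNReal := fun j => (∫⁻ y in ({0}ᶜ : Set (EuclideanSpace ℝ (Fin n))),
    ENNReal.ofReal (‖iteratedFDerivWithin ℝ j u ({0}ᶜ : Set (EuclideanSpace ℝ (Fin n))) y‖ ^ p *
                        ‖y‖ ^ (-(δ - (j : ℝ)) * p - (n : ℝ)))) ^ (1 / p) with hI
  have hIeq : ∀ j, (∫⁻ y in ({0}ᶜ : Set (EuclideanSpace ℝ (Fin n))),
      (N j y) ^ p * ENNReal.ofReal (‖y‖ ^ (-(n:ℝ)))) ^ (1 / p) = I j := by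
    intro j
    simp only [hI]
    congr 1
    refine setLIntegral_congr_fun (measurableSet_singleton _).compl fun y hy => ?_
    have hy0 : 0 < ‖y‖ := norm_pos_iff.2 hy
    simp only [hN]
    rw [ENNReal.ofReal_rpow_of_nonneg (by positivity) hp0.le, ← ENNReal.ofReal_mul (by positivity),
      Real.mul_rpow (norm_nonneg _) (by positivity), ← Real.rpow_mul hy0.le, mul_assoc,
      ← Real.rpow_add hy0]
    congr 4
    ring
  have hB : ∀ j ≤ m + 1, ∀ s : ℝ, 0 < s → s ≤ 1 →
      ∫⁻ v in Metric.ball (0 : EuclideanSpace ℝ (Fin n)) (1 / 2), N j (x + (s * ‖x‖) • v) ≤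
      A * (ENNReal.ofReal (s ^ (-(n:ℝ) / p)) * I j) := by
    intro j hj s hs hs1
    have := wse_holder hp1 hx hs hs1 (hNm j hj)
    rwa [hIeq] at this
  set L := ENNReal.ofReal (‖x‖ ^ (-δ) * |u x|) with hL
  have hNm' := hNm (m + 1) le_rfl
  have hmain : V * L ≤ K * (A * (1 + T)) * ∑ j ∈ Finset.range (m + 1 + 1), I j := by
    calc V * L = ∫⁻ v in Metric.ball (0 : EuclideanSpace ℝ (Fin n)) (1 / 2), L := by
          rw [setLIntegral_const, mul_comm]
      _ ≤ ∫⁻ v in Metric.ball (0 : EuclideanSpace ℝ (Fin n)) (1 / 2),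
          K * (∑ j ∈ Finset.range (m + 1), N j (x + ‖x‖ • v) +
      ∫⁻ s in Set.Ioc (0:ℝ) 1, ENNReal.ofReal (s ^ m) * N (m + 1) (x + (s * ‖x‖) • v)) := by
          refine setLIntegral_mono' measurableSet_ball fun v hv => ?_
          exact wse_scaled hu hx (mem_ball_zero_iff.1 hv).le N (fun _ _ => rfl)
      _ = K * (∑ j ∈ Finset.range (m + 1),
            (∫⁻ v in Metric.ball (0 : EuclideanSpace ℝ (Fin n)) (1 / 2), N j (x + ‖x‖ • v)) +
          ∫⁻ s in Set.Ioc (0:ℝ) 1, ENNReal.ofReal (s ^ m) *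
            ∫⁻ v in Metric.ball (0 : EuclideanSpace ℝ (Fin n)) (1 / 2),
              N (m + 1) (x + (s * ‖x‖) • v)) := by
          have hms : ∀ j ∈ Finset.range (m + 1), Measurable fun v => N j (x + ‖x‖ • v) := by
            intro j hj
            exact (hNm j (Finset.mem_range.1 hj).le).comp (by fun_prop)
          rw [lintegral_const_mul' _ _ ENNReal.ofReal_ne_top, lintegral_add_left
            (Finset.measurable_sum _ hms), lintegral_finsetSum _ hms, lintegral_lintegral_swap]
          · congr 2
            refine lintegral_congr fun s => ?_
            rw [lintegral_const_mul' _ _ ENNReal.ofReal_ne_top]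
          · refine Measurable.aemeasurable ?_
            refine Measurable.mul (f := fun q : EuclideanSpace ℝ (Fin n) × ℝ => ENNReal.ofReal (q.2 ^ m))
              (by fun_prop) ?_
            exact hNm'.comp (f := fun q : EuclideanSpace ℝ (Fin n) × ℝ => x + (q.2 * ‖x‖) • q.1)
              (by fun_prop)
      _ ≤ K * (∑ j ∈ Finset.range (m + 1), A * I j + A * T * I (m + 1)) := by
          refine mul_le_mul_right (add_le_add (Finset.sum_le_sum fun j hj => ?_) ?_) _
          · have := hB j (Finset.mem_range.1 hj).le 1 one_pos le_rfl
            simpa using this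
          · have hTI : A * T * I (m + 1) = ∫⁻ s in Set.Ioc (0:ℝ) 1, A *
                ((ENNReal.ofReal (s ^ m) * ENNReal.ofReal (s ^ (-(n:ℝ) / p))) * I (m + 1)) := by
              rw [lintegral_const_mul' _ _ hAt, lintegral_mul_const _ (by fun_prop), mul_assoc]
            rw [hTI]
            refine setLIntegral_mono' measurableSet_Ioc fun s hs => ?_
            refine (mul_le_mul_right (hB (m + 1) le_rfl s hs.1 hs.2) _).trans (le_of_eq ?_)
            ring
      _ ≤ K * (A * (1 + T) * ∑ j ∈ Finset.range (m + 1), I j + A * (1 + T) * I (m + 1)) := by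
          rw [← Finset.mul_sum]
          have h1 : A ≤ A * (1 + T) := le_mul_of_one_le_right' le_self_add
          have h2 : A * T ≤ A * (1 + T) := mul_le_mul_right le_add_self _
          gcongr
      _ = _ := by rw [Finset.sum_range_succ _ (m + 1)]; ring
  have hfin : L = V⁻¹ * (V * L) := by
    rw [← mul_assoc, ENNReal.inv_mul_cancel hV0 hVt, one_mul]
  rw [hfin, hD, mul_assoc]
  exact mul_le_mul_right hmain _
end

section
/- Let n ≥ 1, k ≥ 1 be integers and 1 ≤ p < ∞ with kp > n, and let δ ∈ ℝ. Suppose u : ℝⁿ \ {0} → ℝ is k-times continuously differentiable and all the weighted integrals ∫_{ℝⁿ\{0}} ‖D^j u(y)‖^p ‖y‖^{-(δ-j)p-n} dy for j = 0,…,k are finite. Then ‖x‖^{-δ}|u(x)| → 0 as ‖x‖ → 0 and ‖x‖^{-δ}|u(x)| → 0 as ‖x‖ → ∞. -/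
open MeasureTheory Filter
open scoped ENNReal


lemma aux_jensen {α : Type*} [MeasurableSpace α] (μ : Measure α) (G : α → ℝ≥0∞)
    (hG : Measurable G) (p : ℝ) (hp : 1 ≤ p) :
    ∫⁻ a, G a ∂μ ≤ (∫⁻ a, G a ^ p ∂μ) ^ (1 / p) * μ Set.univ ^ (1 - 1 / p) := by
  have := eLpNorm'_le_eLpNorm'_mul_rpow_measure_univ (μ := μ) (f := G) one_pos hp
    hG.aestronglyMeasurable
  simpa [eLpNorm'] using this

lemma aux_scale (n : ℕ) (G : (EuclideanSpace ℝ (Fin n)) → ℝ≥0∞) (hG : Measurable G) (x : EuclideanSpace ℝ (Fin n)) (r : ℝ) (hr : 0 < r) :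
    ∫⁻ z in Metric.ball (0 : EuclideanSpace ℝ (Fin n)) 1, G (x + r • z) =
      ENNReal.ofReal r ^ (-(n : ℝ)) * ∫⁻ y in Metric.ball x r, G y := by
  rw [← lintegral_indicator Metric.isOpen_ball.measurableSet,
    ← lintegral_indicator Metric.isOpen_ball.measurableSet]
  rw [← lintegral_add_left_eq_self (μ := volume) ((Metric.ball x r).indicator G) x]
  have hm : Measurable (fun y : EuclideanSpace ℝ (Fin n) => (Metric.ball x r).indicator G (x + y)) :=
    (hG.indicator Metric.isOpen_ball.measurableSet).comp (measurable_const_add x)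
  have h1 : ENNReal.ofReal r ^ (-(n : ℝ)) =
      ENNReal.ofReal (abs (r ^ Module.finrank ℝ (EuclideanSpace ℝ (Fin n)))⁻¹) := by
    rw [ENNReal.ofReal_rpow_of_pos hr, Real.rpow_neg hr.le, Real.rpow_natCast, abs_of_pos (by positivity)]
    simp
  rw [h1, ← smul_eq_mul, ← lintegral_smul_measure, ← Measure.map_addHaar_smul volume hr.ne',
    lintegral_map hm (measurable_const_smul r)]
  congr 1
  ext z
  simp only [Set.indicator, Metric.mem_ball, dist_self_add_left, norm_smul, dist_zero_right,
    Real.norm_eq_abs, abs_of_pos hr]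
  congr 1
  simp only [eq_iff_iff]
  constructor <;> intro h <;> nlinarith

lemma aux_avg (n : ℕ) (G : (EuclideanSpace ℝ (Fin n)) → ℝ≥0∞) (hG : Measurable G) (x : EuclideanSpace ℝ (Fin n)) (p : ℝ) (hp : 1 ≤ p)
    (R t : ℝ) (hR : 0 < R) (ht : 0 < t) (ht1 : t ≤ 1) :
    ∫⁻ z in Metric.ball (0 : EuclideanSpace ℝ (Fin n)) 1, G (x + t • R • z) ≤
      volume (Metric.ball (0 : EuclideanSpace ℝ (Fin n)) 1) ^ (1 - 1 / p) * ENNReal.ofReal t ^ (-(n : ℝ) / p) *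
      (ENNReal.ofReal R ^ (-(n : ℝ)) * ∫⁻ y in Metric.ball x R, G y ^ p) ^ (1 / p) := by
  have hp0 : 0 < p := by linarith
  refine (aux_jensen (volume.restrict (Metric.ball (0 : EuclideanSpace ℝ (Fin n)) 1)) (fun z => G (x + t • R • z))
    (hG.comp (by fun_prop)) p hp).trans ?_
  rw [Measure.restrict_apply_univ, mul_comm, mul_assoc]
  gcongr
  have := aux_scale n (fun y => G y ^ p) (hG.pow_const p) x (t * R) (by positivity)
  simp only [smul_smul]
  rw [this, ENNReal.ofReal_mul ht.le, ENNReal.mul_rpow_of_ne_zero (x := ENNReal.ofReal t) (y := ENNReal.ofReal R)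
    (by simpa using ht) (by simpa using hR), mul_assoc,
    ENNReal.mul_rpow_of_nonneg _ _ (by positivity), ← ENNReal.rpow_mul, mul_one_div]
  gcongr
  nlinarith

lemma aux_taylor (n k : ℕ) (u : (EuclideanSpace ℝ (Fin n)) → ℝ) (hu : ContDiffOn ℝ (k + 1 : ℕ) u {0}ᶜ) (x w : EuclideanSpace ℝ (Fin n))
    (hw : ∀ t ∈ Set.Icc (0 : ℝ) 1, x + t • w ≠ 0) :
    ‖u x‖ₑ ≤ ∑ j ∈ Finset.range (k + 1), ‖w‖ₑ ^ j * ‖iteratedFDerivWithin ℝ j u {0}ᶜ (x + w)‖ₑ +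
      ∫⁻ t in Set.Ioo (0 : ℝ) 1, ENNReal.ofReal (1 - t) ^ k * (‖w‖ₑ ^ (k + 1) *
        ‖iteratedFDerivWithin ℝ (k + 1) u {0}ᶜ (x + (1 - t) • w)‖ₑ) := by
  have hop : IsOpen ({0}ᶜ : Set (EuclideanSpace ℝ (Fin n))) := isOpen_compl_singleton
  have key := map_add_eq_sum_add_integral_iteratedFDeriv (f := u) (x := x + w) (y := -w) (n := k)
    (by
      intro t ht
      have h := hw (1 - t) ⟨by linarith [ht.2], by linarith [ht.1]⟩
      have e : x + w + t • -w = x + (1 - t) • w := by module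
      rw [e]
      exact_mod_cast hu.contDiffAt (hop.mem_nhds h))
  have e0 : x + w + -w = x := by simp
  have hb : ∀ (j : ℕ) (y : EuclideanSpace ℝ (Fin n)), y ≠ 0 → ‖iteratedFDeriv ℝ j u y (fun _ => -w)‖ₑ ≤
      ‖w‖ₑ ^ j * ‖iteratedFDerivWithin ℝ j u {0}ᶜ y‖ₑ := by
    intro j y hy
    rw [iteratedFDerivWithin_of_isOpen j hop hy]
    have := (iteratedFDeriv ℝ j u y).le_opNorm (fun _ => -w)
    simp only [norm_neg, Finset.prod_const, Finset.card_univ, Fintype.card_fin] at this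
    rw [mul_comm, ← ofReal_norm, ← ofReal_norm, ← ofReal_norm,
      ← ENNReal.ofReal_pow (norm_nonneg _), ← ENNReal.ofReal_mul (norm_nonneg _)]
    exact ENNReal.ofReal_le_ofReal this
  have hf : ∀ j : ℕ, ‖((j.factorial : ℝ)⁻¹)‖ₑ ≤ 1 := by
    intro j
    rw [← ofReal_norm, ENNReal.ofReal_le_one, norm_inv, Real.norm_natCast]
    exact inv_le_one_of_one_le₀ (by exact_mod_cast j.factorial_pos)
  rw [e0] at key
  rw [key]
  refine (enorm_add_le _ _).trans (add_le_add ?_ ?_)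
  · refine (enorm_sum_le _ _).trans (Finset.sum_le_sum fun j _ => ?_)
    rw [enorm_smul]
    refine (mul_le_mul' (hf j) (hb j _ ?_)).trans (by simp)
    simpa using hw 1 (by simp)
  · rw [enorm_smul, intervalIntegral.integral_of_le zero_le_one, integral_Ioc_eq_integral_Ioo]
    refine (mul_le_mul' (hf k) (enorm_integral_le_lintegral_enorm _)).trans ?_
    rw [one_mul]
    refine setLIntegral_mono' measurableSet_Ioo fun t ht => ?_
    have e : x + w + t • -w = x + (1 - t) • w := by module
    rw [enorm_smul, e, enorm_pow]
    refine mul_le_mul' ?_ (hb _ _ (hw _ ⟨by linarith [ht.2], by linarith [ht.1]⟩))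
    rw [Real.enorm_of_nonneg (by linarith [ht.2])]

lemma aux_K (k : ℕ) (a : ℝ) (ha : -1 < k + a) :
    ∫⁻ t in Set.Ioo (0 : ℝ) 1, ENNReal.ofReal (1 - t) ^ k * ENNReal.ofReal (1 - t) ^ a ≠ ⊤ := by
  have h : IntervalIntegrable (fun t : ℝ => (1 - t) ^ ((k : ℝ) + a)) volume 0 1 := by
    have := (intervalIntegral.intervalIntegrable_rpow' (a := 0) (b := 1) ha).comp_sub_left 1
    simpa using this.symm
  rw [intervalIntegrable_iff_integrableOn_Ioo_of_le zero_le_one] at h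
  have h2 := h.lintegral_lt_top
  refine ne_of_lt (lt_of_le_of_lt (le_of_eq ?_) h2)
  refine setLIntegral_congr_fun measurableSet_Ioo fun t ht => ?_
  have : 0 < 1 - t := by linarith [ht.2]
  rw [← ENNReal.ofReal_rpow_of_pos this, ENNReal.rpow_add _ _ (by simpa using ht.2) (by simp),
    ENNReal.rpow_natCast]

lemma aux_sobolev (n k : ℕ) (p : ℝ) (hp : 1 ≤ p) (hkp : (n : ℝ) < ((k + 1 : ℕ) : ℝ) * p)
    (u : (EuclideanSpace ℝ (Fin n)) → ℝ) (hu : ContDiffOn ℝ (k + 1 : ℕ) u {0}ᶜ)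
    (G : ℕ → (EuclideanSpace ℝ (Fin n)) → ℝ≥0∞) (hG : ∀ j ≤ k + 1, Measurable (G j))
    (hGu : ∀ j, ∀ y ≠ 0, G j y = ‖iteratedFDerivWithin ℝ j u {0}ᶜ y‖ₑ) :
    ∃ C : ℝ≥0∞, C ≠ ⊤ ∧ ∀ x : EuclideanSpace ℝ (Fin n), x ≠ 0 → ‖u x‖ₑ ≤ C * ∑ j ∈ Finset.range (k + 2),
      ENNReal.ofReal (‖x‖ / 2) ^ j * (ENNReal.ofReal (‖x‖ / 2) ^ (-(n : ℝ)) *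
        ∫⁻ y in Metric.ball x (‖x‖ / 2), G j y ^ p) ^ (1 / p) := by
  have hp0 : 0 < p := by linarith
  set V := volume (Metric.ball (0 : EuclideanSpace ℝ (Fin n)) 1) with hV
  have hV0 : V ≠ 0 := (Metric.measure_ball_pos volume _ one_pos).ne'
  have hVt : V ≠ ⊤ := measure_ball_lt_top.ne
  set W := V ^ (1 - 1 / p)
  have hW : W ≠ ⊤ := ENNReal.rpow_ne_top_of_nonneg
    (by rw [sub_nonneg, div_le_one hp0]; exact hp) hVt
  set K := ∫⁻ t in Set.Ioo (0 : ℝ) 1,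
    ENNReal.ofReal (1 - t) ^ k * ENNReal.ofReal (1 - t) ^ (-(n : ℝ) / p) with hK
  have hKt : K ≠ ⊤ := aux_K k _ (by
    push_cast at hkp
    have : (n : ℝ) / p < k + 1 := by rwa [div_lt_iff₀ hp0]
    rw [neg_div]; linarith)
  refine ⟨V⁻¹ * (W * (1 + K)), by finiteness, fun x hx => ?_⟩
  set R := ‖x‖ / 2 with hR
  have hR0 : 0 < R := by have := norm_pos_iff.2 hx; positivity
  set S : ℕ → ℝ≥0∞ := fun j => (ENNReal.ofReal R ^ (-(n : ℝ)) *
        ∫⁻ y in Metric.ball x R, G j y ^ p) ^ (1 / p) with hS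
  have hne : ∀ z ∈ Metric.ball (0 : EuclideanSpace ℝ (Fin n)) 1, ∀ t ∈ Set.Icc (0 : ℝ) 1, x + t • R • z ≠ 0 := by
    intro z hz t ht h
    have hz : ‖z‖ < 1 := by simpa using hz
    have : x = - (t • R • z) := eq_neg_of_add_eq_zero_left h
    have h2 : ‖x‖ = t * (R * ‖z‖) := by
      conv_lhs => rw [this, norm_neg, norm_smul, norm_smul, Real.norm_of_nonneg ht.1,
        Real.norm_of_nonneg hR0.le]
    have h3 : R * ‖z‖ ≤ R := by nlinarith
    have h4 : t * (R * ‖z‖) ≤ 1 * R := mul_le_mul ht.2 h3 (by positivity) zero_le_one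
    linarith
  have main : V * ‖u x‖ₑ ≤ W * (1 + K) * ∑ j ∈ Finset.range (k + 2), ENNReal.ofReal R ^ j * S j := by
    calc V * ‖u x‖ₑ = ∫⁻ z in Metric.ball (0 : EuclideanSpace ℝ (Fin n)) 1, ‖u x‖ₑ := by
          rw [setLIntegral_const, mul_comm]
      _ ≤ ∫⁻ z in Metric.ball (0 : EuclideanSpace ℝ (Fin n)) 1,
          ((∑ j ∈ Finset.range (k + 1), ENNReal.ofReal R ^ j * G j (x + (1 : ℝ) • R • z)) +
          ∫⁻ t in Set.Ioo (0 : ℝ) 1, ENNReal.ofReal (1 - t) ^ k * (ENNReal.ofReal R ^ (k + 1) *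
            G (k + 1) (x + (1 - t) • R • z))) := by
          refine setLIntegral_mono' measurableSet_ball fun z hz => ?_
          refine (aux_taylor n k u hu x (R • z) (hne z hz)).trans ?_
          have hw : ‖R • z‖ₑ ≤ ENNReal.ofReal R := by
            rw [enorm_smul, Real.enorm_of_nonneg hR0.le]
            refine mul_le_of_le_one_right (by simp) ?_
            have hz : ‖z‖ < 1 := by simpa using hz
            rw [← ofReal_norm]
            exact ENNReal.ofReal_le_one.2 hz.le
          refine add_le_add (Finset.sum_le_sum fun j hj => ?_)
            (setLIntegral_mono' measurableSet_Ioo fun t ht => ?_)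
          · have := hne z hz 1 (by simp)
            rw [hGu j _ this, one_smul]
            gcongr
          · have := hne z hz (1 - t) ⟨by linarith [ht.2], by linarith [ht.1]⟩
            rw [hGu _ _ this]
            gcongr
      _ = (∑ j ∈ Finset.range (k + 1), ENNReal.ofReal R ^ j *
            ∫⁻ z in Metric.ball (0 : EuclideanSpace ℝ (Fin n)) 1, G j (x + (1 : ℝ) • R • z)) +
          ∫⁻ t in Set.Ioo (0 : ℝ) 1, ENNReal.ofReal (1 - t) ^ k * (ENNReal.ofReal R ^ (k + 1) *
            ∫⁻ z in Metric.ball (0 : EuclideanSpace ℝ (Fin n)) 1, G (k + 1) (x + (1 - t) • R • z)) := by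
          have hm : ∀ j ∈ Finset.range (k + 1), Measurable fun z : EuclideanSpace ℝ (Fin n) =>
              G j (x + (1 : ℝ) • R • z) := fun j hj =>
            (hG j (by simp at hj; omega)).comp (by fun_prop)
          have hm2 : Measurable fun q : (EuclideanSpace ℝ (Fin n)) × ℝ => G (k + 1) (x + (1 - q.2) • R • q.1) :=
            (hG (k + 1) le_rfl).comp (by fun_prop)
          rw [lintegral_add_left (Finset.measurable_fun_sum _ fun j hj => (hm j hj).const_mul _),
            lintegral_finsetSum' _ fun j hj => ((hm j hj).const_mul _).aemeasurable]
          congr 1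
          · exact Finset.sum_congr rfl fun j hj => lintegral_const_mul _ (hm j hj)
          · rw [lintegral_lintegral_swap]
            · congr 1
              ext t
              have hm3 : Measurable fun z : EuclideanSpace ℝ (Fin n) => G (k + 1) (x + (1 - t) • R • z) :=
                (hG (k + 1) le_rfl).comp (by fun_prop)
              rw [lintegral_const_mul _ (hm3.const_mul _), lintegral_const_mul _ hm3]
            · refine Measurable.aemeasurable ?_
              exact Measurable.mul (by fun_prop) (hm2.const_mul _)
      _ ≤ (∑ j ∈ Finset.range (k + 1), ENNReal.ofReal R ^ j * (W * S j)) +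
          ∫⁻ t in Set.Ioo (0 : ℝ) 1, ENNReal.ofReal (1 - t) ^ k * (ENNReal.ofReal R ^ (k + 1) *
            (W * ENNReal.ofReal (1 - t) ^ (-(n : ℝ) / p) * S (k + 1))) := by
          refine add_le_add (Finset.sum_le_sum fun j hj => ?_)
            (setLIntegral_mono' measurableSet_Ioo fun t ht => ?_)
          · have := aux_avg n (G j) (hG j (by simp at hj; omega)) x p hp R 1 hR0 one_pos le_rfl
            simp only [ENNReal.ofReal_one, ENNReal.one_rpow, mul_one] at this
            gcongr
          · have := aux_avg n (G (k + 1)) (hG _ le_rfl) x p hp R (1 - t) hR0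
              (by linarith [ht.2]) (by linarith [ht.1])
            gcongr
      _ = W * (∑ j ∈ Finset.range (k + 1), ENNReal.ofReal R ^ j * S j) +
          W * K * (ENNReal.ofReal R ^ (k + 1) * S (k + 1)) := by
          congr 1
          · rw [Finset.mul_sum]
            exact Finset.sum_congr rfl fun j hj => by ring
          · rw [mul_comm W K, mul_assoc, hK, ← lintegral_mul_const _ (by fun_prop)]
            congr 1
            ext t
            ring
      _ ≤ W * (1 + K) * (∑ j ∈ Finset.range (k + 1), ENNReal.ofReal R ^ j * S j) +
          W * (1 + K) * (ENNReal.ofReal R ^ (k + 1) * S (k + 1)) := by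
          gcongr
          · exact le_mul_of_one_le_right (by simp) (by simp)
          · simp
      _ = _ := by rw [Finset.sum_range_succ _ (k + 1), ← mul_add]
  calc ‖u x‖ₑ = V⁻¹ * (V * ‖u x‖ₑ) := by
        rw [← mul_assoc, ENNReal.inv_mul_cancel hV0 hVt, one_mul]
    _ ≤ V⁻¹ * (W * (1 + K) * ∑ j ∈ Finset.range (k + 2), ENNReal.ofReal R ^ j * S j) := by gcongr
    _ = _ := by rw [← mul_assoc]

lemma aux_weight {n : ℕ} (x y : EuclideanSpace ℝ (Fin n)) (hx : x ≠ 0) (hy : y ∈ Metric.ball x (‖x‖ / 2)) (a : ℝ) :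
    (‖x‖ / 2) ^ a ≤ 3 ^ |a| * ‖y‖ ^ a := by
  have hx0 := norm_pos_iff.2 hx
  rw [Metric.mem_ball, dist_eq_norm] at hy
  have h1 : ‖x‖ ≤ ‖y‖ + ‖y - x‖ := by
    have := norm_sub_norm_le x y
    rw [norm_sub_rev] at this
    linarith
  have h2 : ‖y‖ ≤ ‖x‖ + ‖y - x‖ := by
    have := norm_sub_norm_le y x
    linarith
  have hy0 : 0 < ‖y‖ := by linarith
  rcases le_total 0 a with ha | ha
  · rw [abs_of_nonneg ha, ← Real.mul_rpow (by norm_num) hy0.le]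
    exact Real.rpow_le_rpow (by positivity) (by linarith) ha
  · rw [abs_of_nonpos ha, Real.rpow_neg (by norm_num), ← Real.inv_rpow (by norm_num),
      ← Real.mul_rpow (by norm_num) hy0.le]
    exact Real.rpow_le_rpow_of_nonpos (by positivity) (by linarith) ha

lemma aux_term {n : ℕ} (p δ : ℝ) (hp : 1 ≤ p) (j : ℕ) (N : (EuclideanSpace ℝ (Fin n)) → ℝ) (hN : ∀ y, 0 ≤ N y)
    (G : (EuclideanSpace ℝ (Fin n)) → ℝ≥0∞)
    (hG : Measurable G) (hGN : ∀ y ≠ 0, G y = ENNReal.ofReal (N y)) (x : EuclideanSpace ℝ (Fin n)) (hx : x ≠ 0) :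
    ENNReal.ofReal (‖x‖ ^ (-δ)) *
      (ENNReal.ofReal (‖x‖ / 2) ^ j * (ENNReal.ofReal (‖x‖ / 2) ^ (-(n : ℝ)) *
        ∫⁻ y in Metric.ball x (‖x‖ / 2), G y ^ p) ^ (1 / p)) ≤
    ENNReal.ofReal (2 ^ (-δ)) * (ENNReal.ofReal (3 ^ |-(δ - (j : ℝ)) * p - (n : ℝ)|) *
      ∫⁻ y in ({0}ᶜ : Set (EuclideanSpace ℝ (Fin n))), (Metric.ball x (‖x‖ / 2)).indicator (fun y =>
        ENNReal.ofReal (N y ^ p * ‖y‖ ^ (-(δ - (j : ℝ)) * p - (n : ℝ)))) y) ^ (1 / p) := by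
  have hp0 : 0 < p := by linarith
  have hx0 := norm_pos_iff.2 hx
  set a := -(δ - (j : ℝ)) * p - (n : ℝ) with ha
  set R := ‖x‖ / 2 with hR
  have hR0 : 0 < R := by positivity
  have hx2 : ‖x‖ = 2 * R := by rw [hR]; ring
  set ρ := ENNReal.ofReal R with hρ
  have hρ0 : ρ ≠ 0 := by simpa [hρ] using hR0
  have hρt : ρ ≠ ⊤ := by simp [hρ]
  have hball : Metric.ball x R ⊆ {0}ᶜ := by
    intro y hy h0
    have : y = 0 := h0
    subst this
    rw [Metric.mem_ball, dist_zero_left] at hy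
    linarith
  have h1 : ENNReal.ofReal (‖x‖ ^ (-δ)) = ENNReal.ofReal (2 ^ (-δ)) * (ρ ^ (-δ * p)) ^ (1 / p) := by
    rw [← ENNReal.rpow_mul, mul_assoc, mul_one_div_cancel hp0.ne', mul_one,
      ENNReal.ofReal_rpow_of_pos hR0,
      ← ENNReal.ofReal_mul (by positivity), hx2, Real.mul_rpow (by norm_num) hR0.le]
  have h2 : ρ ^ j = (ρ ^ (j * p)) ^ (1 / p) := by
    rw [← ENNReal.rpow_mul, mul_assoc, mul_one_div_cancel hp0.ne', mul_one, ENNReal.rpow_natCast]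
  have hpp : 0 ≤ 1 / p := by positivity
  rw [h1, h2, ← ENNReal.mul_rpow_of_nonneg _ _ hpp, mul_assoc, ← ENNReal.mul_rpow_of_nonneg _ _ hpp,
    ← mul_assoc, ← mul_assoc, ← ENNReal.rpow_add _ _ hρ0 hρt, ← ENNReal.rpow_add _ _ hρ0 hρt]
  have e : -δ * p + j * p + -(n : ℝ) = a := by rw [ha]; ring
  rw [e]
  refine mul_le_mul_right (ENNReal.rpow_le_rpow ?_ hpp) _
  rw [setLIntegral_indicator measurableSet_ball, Set.inter_eq_left.2 hball,
    ← lintegral_const_mul' _ _ (by simp [hρ0, hρt]), ← lintegral_const_mul' _ _ (by simp)]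
  refine setLIntegral_mono' measurableSet_ball fun y hy => ?_
  rw [hGN y (hball hy), ENNReal.ofReal_rpow_of_nonneg (hN y) hp0.le, hρ,
    ENNReal.ofReal_rpow_of_pos hR0, ← ENNReal.ofReal_mul (by positivity),
    ← ENNReal.ofReal_mul (by positivity)]
  refine ENNReal.ofReal_le_ofReal ?_
  have := aux_weight x y hx hy a
  have := mul_le_mul_of_nonneg_right this (Real.rpow_nonneg (hN y) p)
  calc _ ≤ _ := this
    _ = _ := by ring

lemma aux_tail {n : ℕ} (f : (EuclideanSpace ℝ (Fin n)) → ℝ≥0∞)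
    (hf : AEMeasurable f (volume.restrict ({0}ᶜ : Set (EuclideanSpace ℝ (Fin n)))))
    (hfin : ∫⁻ y in ({0}ᶜ : Set (EuclideanSpace ℝ (Fin n))), f y < ⊤)
    (l : Filter (EuclideanSpace ℝ (Fin n))) [l.IsCountablyGenerated]
    (hl : ∀ y : EuclideanSpace ℝ (Fin n), y ≠ 0 → ∀ᶠ x in l, y ∉ Metric.ball x (‖x‖ / 2)) :
    Tendsto (fun x => ∫⁻ y in ({0}ᶜ : Set (EuclideanSpace ℝ (Fin n))), (Metric.ball x (‖x‖ / 2)).indicator f y) l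
      (nhds 0) := by
  have := tendsto_lintegral_filter_of_dominated_convergence'
    (μ := volume.restrict ({0}ᶜ : Set (EuclideanSpace ℝ (Fin n)))) (l := l)
    (F := fun x => (Metric.ball x (‖x‖ / 2)).indicator f) (f := fun _ => 0) f
    (Eventually.of_forall fun x => hf.indicator measurableSet_ball)
    (Eventually.of_forall fun x => Eventually.of_forall fun y => Set.indicator_le_self _ _ _)
    hfin.ne (by
      filter_upwards [ae_restrict_mem (measurableSet_singleton (0 : EuclideanSpace ℝ (Fin n))).compl] with y hy
      refine tendsto_const_nhds.congr' ?_
      filter_upwards [hl y hy] with x hx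
      simp [Set.indicator_of_notMem hx])
  simpa using this

/-- Decay of functions in Bartnik's weighted Sobolev space `W'^{k,p}_δ` on `ℝⁿ \ {0}`
with `kp > n`: if all the weighted integrals
`∫ ‖D^j u‖^p ‖y‖^{-(δ-j)p-n}` for `j = 0,…,k` are finite, then
`‖x‖^{-δ} |u x| → 0` both as `‖x‖ → 0` and as `‖x‖ → ∞`. -/
theorem weighted_sobolev_decay (n k : ℕ) (hn : 1 ≤ n) (hk : 1 ≤ k)
    (p δ : ℝ) (hp1 : 1 ≤ p) (hkp : (n : ℝ) < (k : ℝ) * p)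
    (u : EuclideanSpace ℝ (Fin n) → ℝ)
    (hu : ContDiffOn ℝ k u {0}ᶜ)
    (hint : ∀ j ≤ k,
      (∫⁻ y in ({0}ᶜ : Set (EuclideanSpace ℝ (Fin n))),
          ENNReal.ofReal
            (‖iteratedFDerivWithin ℝ j u ({0}ᶜ : Set (EuclideanSpace ℝ (Fin n))) y‖ ^ p *
              ‖y‖ ^ (-(δ - (j : ℝ)) * p - (n : ℝ)))) < ⊤) :
    Tendsto (fun x : EuclideanSpace ℝ (Fin n) => ‖x‖ ^ (-δ) * |u x|)
        (nhdsWithin 0 ({0}ᶜ : Set (EuclideanSpace ℝ (Fin n)))) (nhds 0) ∧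
      Tendsto (fun x : EuclideanSpace ℝ (Fin n) => ‖x‖ ^ (-δ) * |u x|)
        (comap (fun x : EuclideanSpace ℝ (Fin n) => ‖x‖) atTop) (nhds 0) := by
  obtain ⟨k, rfl⟩ : ∃ m, k = m + 1 := ⟨k - 1, by omega⟩
  have hp0 : 0 < p := by linarith
  have hms : MeasurableSet ({0}ᶜ : Set (EuclideanSpace ℝ (Fin n))) := (measurableSet_singleton _).compl
  have hcont : ∀ j ≤ k + 1, ContinuousOn (iteratedFDerivWithin ℝ j u ({0}ᶜ : Set (EuclideanSpace ℝ (Fin n)))) {0}ᶜ :=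
    fun j hj => hu.continuousOn_iteratedFDerivWithin (by exact_mod_cast hj)
      isOpen_compl_singleton.uniqueDiffOn
  let G : ℕ → (EuclideanSpace ℝ (Fin n)) → ℝ≥0∞ := fun j =>
    ({0}ᶜ : Set (EuclideanSpace ℝ (Fin n))).indicator fun y => ‖iteratedFDerivWithin ℝ j u {0}ᶜ y‖ₑ
  have hGu : ∀ j, ∀ y ≠ 0, G j y = ‖iteratedFDerivWithin ℝ j u {0}ᶜ y‖ₑ := fun j y hy =>
    Set.indicator_of_mem (by simpa using hy) _
  have hG : ∀ j ≤ k + 1, Measurable (G j) := by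
    intro j hj
    have h : ContinuousOn (fun y => ‖iteratedFDerivWithin ℝ j u ({0}ᶜ : Set (EuclideanSpace ℝ (Fin n))) y‖ₑ) {0}ᶜ :=
      (hcont j hj).enorm
    have := h.measurable_piecewise (g := (0 : (EuclideanSpace ℝ (Fin n)) → ℝ≥0∞)) continuous_zero.continuousOn hms
    rwa [Set.piecewise_eq_indicator] at this
  obtain ⟨C, hC, hsob⟩ := aux_sobolev n k p hp1 hkp u hu G hG hGu
  have gen : ∀ (l : Filter (EuclideanSpace ℝ (Fin n))) [l.IsCountablyGenerated], (∀ᶠ x in l, x ≠ 0) →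
      (∀ y : EuclideanSpace ℝ (Fin n), y ≠ 0 → ∀ᶠ x in l, y ∉ Metric.ball x (‖x‖ / 2)) →
      Tendsto (fun x : EuclideanSpace ℝ (Fin n) => ‖x‖ ^ (-δ) * |u x|) l (nhds 0) := by
    intro l _ hl0 hl
    have htail : ∀ j ∈ Finset.range (k + 2), Tendsto (fun x : EuclideanSpace ℝ (Fin n) => ENNReal.ofReal (2 ^ (-δ)) *
        (ENNReal.ofReal (3 ^ |-(δ - (j : ℝ)) * p - (n : ℝ)|) *
      ∫⁻ y in ({0}ᶜ : Set (EuclideanSpace ℝ (Fin n))), (Metric.ball x (‖x‖ / 2)).indicator (fun y =>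
        ENNReal.ofReal (‖iteratedFDerivWithin ℝ j u ({0}ᶜ : Set (EuclideanSpace ℝ (Fin n))) y‖ ^ p *
          ‖y‖ ^ (-(δ - (j : ℝ)) * p - (n : ℝ)))) y) ^ (1 / p)) l (nhds 0) := by
      intro j hj
      have hj : j ≤ k + 1 := by simp at hj; omega
      have h0 := aux_tail _ (by
        refine ContinuousOn.aemeasurable ?_ hms
        refine ENNReal.continuous_ofReal.comp_continuousOn ?_
        refine ((hcont j hj).norm.rpow_const fun y hy => Or.inr hp0.le).mul
          (continuous_norm.continuousOn.rpow_const fun y hy => Or.inl ?_)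
        simpa using hy) (hint j hj) l hl
      have h1 := ENNReal.Tendsto.const_mul (a := ENNReal.ofReal (3 ^ |-(δ - (j : ℝ)) * p - (n : ℝ)|))
        h0 (Or.inr ENNReal.ofReal_ne_top)
      have h2 := h1.ennrpow_const (1 / p)
      have h3 := ENNReal.Tendsto.const_mul (a := ENNReal.ofReal (2 ^ (-δ)))
        h2 (Or.inr ENNReal.ofReal_ne_top)
      simpa [ENNReal.zero_rpow_of_pos (inv_pos.2 hp0)] using h3
    have hsum := ENNReal.Tendsto.const_mul (a := C) (tendsto_finsetSum _ htail) (Or.inr hC)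
    simp only [Finset.sum_const_zero, mul_zero] at hsum
    have h0 := tendsto_of_tendsto_of_tendsto_of_le_of_le'
      (f := fun x : EuclideanSpace ℝ (Fin n) => ENNReal.ofReal (‖x‖ ^ (-δ) * |u x|)) tendsto_const_nhds hsum
      (Eventually.of_forall fun _ => zero_le) (hl0.mono fun x hx => by
        refine le_trans ?_ (mul_le_mul_right (Finset.sum_le_sum
          (fun (j : ℕ) (hj : j ∈ Finset.range (k + 2)) =>
          aux_term p δ hp1 j (fun y => ‖iteratedFDerivWithin ℝ j u ({0}ᶜ : Set (EuclideanSpace ℝ (Fin n))) y‖)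
            (fun y => norm_nonneg _) (G j) (hG j (by simp at hj; omega))
            (fun y hy => by rw [hGu j y hy, ofReal_norm]) x hx)) C)
        rw [← Finset.mul_sum, mul_left_comm, ENNReal.ofReal_mul (by positivity)]
        refine mul_le_mul_right ?_ _
        rw [← Real.enorm_eq_ofReal_abs]
        exact hsob x hx)
    have := (ENNReal.tendsto_toReal ENNReal.zero_ne_top).comp h0
    refine this.congr fun x => ?_
    simp only [Function.comp]
    exact ENNReal.toReal_ofReal (by positivity)
  constructor
  · refine gen _ self_mem_nhdsWithin fun y hy => ?_
    have hy0 := norm_pos_iff.2 hy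
    refine mem_nhdsWithin_of_mem_nhds ?_
    filter_upwards [Metric.ball_mem_nhds (0 : EuclideanSpace ℝ (Fin n)) (half_pos hy0)] with x hx hxy
    rw [mem_ball_zero_iff] at hx
    rw [Metric.mem_ball, dist_eq_norm] at hxy
    have := norm_sub_norm_le y x
    linarith [norm_nonneg x]
  · refine gen _ ?_ fun y hy => ?_
    · filter_upwards [tendsto_comap.eventually (eventually_gt_atTop (0 : ℝ))] with x hx
      exact norm_pos_iff.1 hx
    · filter_upwards [tendsto_comap.eventually (eventually_gt_atTop (2 * ‖y‖))] with x hx hxy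
      rw [Metric.mem_ball, dist_eq_norm, norm_sub_rev] at hxy
      have := norm_sub_norm_le x y
      linarith
end

section
/- With the notation of the extreme Myers–Perry slice data, there is a constant C > 0 (depending only on a and b) such that for all r > 0 and θ ∈ (0, π/2): |Δ₄Φ₀(r,θ)| ≤ C·r^{-6}, where Δ₄ is the flat four-dimensional Laplacian acting on biaxisymmetric functions, Δ₄ f = ∂²f/∂r² + (3/r)·∂f/∂r + r^{-2}·( ∂²f/∂θ² + (cot θ − tan θ)·∂f/∂θ ). -/
noncomputable section

namespace MP

/-- `Σ = r² + ab + a²cos²θ + b²sin²θ`. -/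
def Sig (a b r θ : ℝ) : ℝ :=
  r ^ 2 + a * b + a ^ 2 * Real.cos θ ^ 2 + b ^ 2 * Real.sin θ ^ 2

/-- `A = r² + ab + a²`. -/
def Afun (a b r : ℝ) : ℝ := r ^ 2 + a * b + a ^ 2

/-- `B = r² + ab + b²`. -/
def Bfun (a b r : ℝ) : ℝ := r ^ 2 + a * b + b ^ 2

/-- `σ₁₁ = a²μ sin⁴θ/Σ + A sin²θ`, with `μ = (a+b)²`. -/
def sig11 (a b r θ : ℝ) : ℝ :=
  a ^ 2 * (a + b) ^ 2 * Real.sin θ ^ 4 / Sig a b r θ + Afun a b r * Real.sin θ ^ 2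

/-- `σ₂₂ = b²μ cos⁴θ/Σ + B cos²θ`, with `μ = (a+b)²`. -/
def sig22 (a b r θ : ℝ) : ℝ :=
  b ^ 2 * (a + b) ^ 2 * Real.cos θ ^ 4 / Sig a b r θ + Bfun a b r * Real.cos θ ^ 2

/-- `σ₁₂ = abμ sin²θ cos²θ/Σ`, with `μ = (a+b)²`. -/
def sig12 (a b r θ : ℝ) : ℝ :=
  a * b * (a + b) ^ 2 * Real.sin θ ^ 2 * Real.cos θ ^ 2 / Sig a b r θ

/-- `ρ = r² sinθ cosθ (= ½ r² sin 2θ)`. -/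
def rho (r θ : ℝ) : ℝ := r ^ 2 * Real.sin θ * Real.cos θ

/-- `det σ = σ₁₁σ₂₂ − σ₁₂²`. -/
def detSig (a b r θ : ℝ) : ℝ :=
  sig11 a b r θ * sig22 a b r θ - sig12 a b r θ ^ 2

/-- The conformal factor `Φ₀ > 0`, defined by `Φ₀² = √(det σ)/ρ`. -/
def Phi0 (a b r θ : ℝ) : ℝ := Real.sqrt (Real.sqrt (detSig a b r θ) / rho r θ)

end MP


namespace MP

/-- Partial derivative in the first (radial) variable. -/
def pdr (f : ℝ → ℝ → ℝ) (r θ : ℝ) : ℝ := deriv (fun s => f s θ) r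

/-- Partial derivative in the second (angular) variable. -/
def pdt (f : ℝ → ℝ → ℝ) (r θ : ℝ) : ℝ := deriv (fun t => f r t) θ

/-- The flat four-dimensional Laplacian on biaxisymmetric functions:
`Δ₄ f = ∂²_r f + (3/r)∂_r f + r⁻²(∂²_θ f + (cot θ − tan θ)∂_θ f)`. -/
def Delta4 (f : ℝ → ℝ → ℝ) (r θ : ℝ) : ℝ :=
  pdr (pdr f) r θ + (3 / r) * pdr f r θ +
    (pdt (pdt f) r θ +
        (Real.cos θ / Real.sin θ - Real.sin θ / Real.cos θ) * pdt f r θ) / r ^ 2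

/-- Inner product of differentials in the flat two-metric `dρ² + dz²`
expressed in `(r,θ)`-coordinates:
`⟨df, dg⟩ = r⁻²(∂_r f ∂_r g + r⁻² ∂_θ f ∂_θ g)`. -/
def dInner (f g : ℝ → ℝ → ℝ) (r θ : ℝ) : ℝ :=
  (pdr f r θ * pdr g r θ + pdt f r θ * pdt g r θ / r ^ 2) / r ^ 2

/-- The flat two-dimensional Laplacian in `(r,θ)`-coordinates:
`Δ₂ f = r⁻⁴(r² ∂²_r f + r ∂_r f + ∂²_θ f)`. -/
def Delta2 (f : ℝ → ℝ → ℝ) (r θ : ℝ) : ℝ :=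
  (r ^ 2 * pdr (pdr f) r θ + r * pdr f r θ + pdt (pdt f) r θ) / r ^ 4

end MP


namespace MPaux

open MP

/-- derivatives of a fourth root -/
lemma quarter_deriv (f F F' : ℝ → ℝ) (F'' x : ℝ)
    (hf : ∀ᶠ y in nhds x, f y = Real.sqrt (Real.sqrt (F y)))
    (hpos : ∀ᶠ y in nhds x, 0 < F y)
    (h1 : ∀ᶠ y in nhds x, HasDerivAt F (F' y) y)
    (h2 : HasDerivAt F' F'' x) :
    deriv f x = 1 / 4 * F x ^ (-(3 / 4) : ℝ) * F' x ∧
    deriv (deriv f) x =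
      1 / 4 * F x ^ (-(3 / 4) : ℝ) * (F'' - 3 / 4 * (F' x ^ 2 / F x)) := by
  have key : ∀ᶠ y in nhds x, deriv f y = 1 / 4 * F y ^ (-(3 / 4) : ℝ) * F' y := by
    filter_upwards [hf.eventually_nhds, hpos, h1] with y hy hp hd
    have e : f =ᶠ[nhds y] fun z => F z ^ (1 / 4 : ℝ) := by
      filter_upwards [hy, hd.continuousAt.eventually (lt_mem_nhds hp)] with z hz hpz
      rw [hz, Real.sqrt_eq_rpow, Real.sqrt_eq_rpow, ← Real.rpow_mul hpz.le]
      norm_num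
    rw [e.deriv_eq, (hd.rpow_const (p := (1 / 4 : ℝ)) (Or.inl hp.ne')).deriv]
    norm_num
    ring
  refine ⟨key.self_of_nhds, ?_⟩
  have hp := hpos.self_of_nhds
  have hd := h1.self_of_nhds
  have e : deriv f =ᶠ[nhds x] fun y => 1 / 4 * F y ^ (-(3 / 4) : ℝ) * F' y := key
  rw [e.deriv_eq]
  have hh := ((hd.rpow_const (p := (-(3 / 4) : ℝ)) (Or.inl hp.ne')).const_mul (1 / 4 : ℝ)).mul h2
  have := hh.deriv
  refine Eq.trans this ?_
  rw [Real.rpow_sub_one hp.ne']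
  field_simp
  ring

def qf (a b c : ℝ) : ℝ := a ^ 2 * (1 - c) + b ^ 2 * c
def wf (a b c : ℝ) : ℝ := a * b + b ^ 2 + (a ^ 2 - b ^ 2) * c
def pf (a b c : ℝ) : ℝ := a * b * (a + b) * (a * (1 - c) + b * c)
def tf (a b c : ℝ) : ℝ := pf a b c - qf a b c * wf a b c
def tf1 (a b c : ℝ) : ℝ :=
  a * b * (a + b) * (b - a) - (b ^ 2 - a ^ 2) * wf a b c - qf a b c * (a ^ 2 - b ^ 2)
def tf2 (a b : ℝ) : ℝ := -2 * (b ^ 2 - a ^ 2) * (a ^ 2 - b ^ 2)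

/-- `H` with `u = 1/Σ`. -/
def Hf (a b c u : ℝ) : ℝ := qf a b c + tf a b c * u
def Hc (a b c u : ℝ) : ℝ :=
  (b ^ 2 - a ^ 2) + tf1 a b c * u - tf a b c * (a ^ 2 - b ^ 2) * u ^ 2
def Hcc (a b c u : ℝ) : ℝ :=
  tf2 a b * u - 2 * tf1 a b c * (a ^ 2 - b ^ 2) * u ^ 2
    + 2 * tf a b c * (a ^ 2 - b ^ 2) ^ 2 * u ^ 3
def Kf (a b c u : ℝ) : ℝ := a * b * (a + b) ^ 2 + (a + b) ^ 2 * Hf a b c u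

def uf (a b r c : ℝ) : ℝ := (r ^ 2 + wf a b c)⁻¹

def FF (a b r c : ℝ) : ℝ := 1 + (a + b) ^ 2 / r ^ 2 + Kf a b c (uf a b r c) / r ^ 4

lemma wf_pos {a b c : ℝ} (ha : 0 < a) (hb : 0 < b) (h0 : 0 ≤ c) (h1 : c ≤ 1) :
    a * b ≤ wf a b c := by
  unfold wf
  nlinarith [mul_nonneg (sq_nonneg a) h0, mul_nonneg (sq_nonneg b) (sub_nonneg.2 h1)]

lemma S_pos {a b c : ℝ} (r : ℝ) (ha : 0 < a) (hb : 0 < b) (h0 : 0 ≤ c) (h1 : c ≤ 1) :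
    0 < r ^ 2 + wf a b c := by
  have := wf_pos ha hb h0 h1
  have := mul_pos ha hb
  nlinarith [sq_nonneg r]

lemma Hf_nonneg {a b c : ℝ} (r : ℝ) (ha : 0 < a) (hb : 0 < b) (h0 : 0 ≤ c) (h1 : c ≤ 1) :
    0 ≤ Hf a b c (uf a b r c) := by
  have hS := S_pos r ha hb h0 h1
  have h1' := sub_nonneg.2 h1
  have : Hf a b c (uf a b r c) = (r ^ 2 * qf a b c + pf a b c) * uf a b r c := by
    unfold Hf uf tf
    field_simp
    ring
  rw [this]
  have hu : 0 ≤ uf a b r c := (inv_pos.2 hS).le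
  have hq : 0 ≤ qf a b c := by unfold qf; positivity
  have hp : 0 ≤ pf a b c := by unfold pf; positivity
  positivity

lemma Kf_ge {a b c : ℝ} (r : ℝ) (ha : 0 < a) (hb : 0 < b) (h0 : 0 ≤ c) (h1 : c ≤ 1) :
    a * b * (a + b) ^ 2 ≤ Kf a b c (uf a b r c) := by
  have := Hf_nonneg r ha hb h0 h1
  unfold Kf
  have : 0 ≤ (a + b) ^ 2 * Hf a b c (uf a b r c) := by positivity
  linarith

lemma FF_ge {a b c : ℝ} (r : ℝ) (ha : 0 < a) (hb : 0 < b) (h0 : 0 ≤ c) (h1 : c ≤ 1) :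
    1 ≤ FF a b r c := by
  have := Kf_ge r ha hb h0 h1
  have : 0 ≤ Kf a b c (uf a b r c) := le_trans (by positivity) this
  unfold FF
  have : 0 ≤ (a + b) ^ 2 / r ^ 2 := by positivity
  have : 0 ≤ Kf a b c (uf a b r c) / r ^ 4 := by positivity
  linarith

lemma Phi0_eq {a b r θ : ℝ} (ha : 0 < a) (hb : 0 < b) (hr : 0 < r)
    (hθ : θ ∈ Set.Ioo 0 (Real.pi / 2)) :
    Phi0 a b r θ = Real.sqrt (Real.sqrt (FF a b r (Real.cos θ ^ 2))) := by
  have hs : 0 < Real.sin θ := Real.sin_pos_of_pos_of_lt_pi hθ.1 (by linarith [hθ.2, Real.pi_pos])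
  have hc : 0 < Real.cos θ := Real.cos_pos_of_mem_Ioo ⟨by linarith [hθ.1, Real.pi_pos], hθ.2⟩
  have hS := S_pos r ha hb (sq_nonneg (Real.cos θ)) (Real.cos_sq_le_one θ)
  have hsq : Real.sin θ ^ 2 = 1 - Real.cos θ ^ 2 := Real.sin_sq θ
  have hSig : Sig a b r θ = r ^ 2 + wf a b (Real.cos θ ^ 2) := by
    unfold Sig wf; rw [hsq]; ring
  have hrho : 0 < rho r θ := by unfold rho; positivity
  have hdet : detSig a b r θ = rho r θ ^ 2 * FF a b r (Real.cos θ ^ 2) := by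
    unfold detSig sig11 sig22 sig12 rho FF Kf Hf uf Afun Bfun
    rw [hSig]
    have h4 : Real.sin θ ^ 4 = Real.sin θ ^ 2 * (1 - Real.cos θ ^ 2) := by rw [← hsq]; ring
    rw [h4]
    generalize hx : Real.cos θ ^ 2 = c at *
    have h4c : Real.cos θ ^ 4 = c ^ 2 := by rw [← hx]; ring
    rw [h4c]
    have hm : (r ^ 2 * Real.sin θ * Real.cos θ) ^ 2 = r ^ 4 * (1 - c) * c := by
      rw [← hsq, ← hx]; ring
    rw [hm, hsq]
    unfold tf
    generalize hSS : r ^ 2 + wf a b c = S at *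
    have hw : wf a b c = S - r ^ 2 := by linarith
    have hSe : S = r ^ 2 + (a * b + b ^ 2 + (a ^ 2 - b ^ 2) * c) := by rw [← hSS]; rfl
    rw [hw]
    unfold qf pf
    field_simp
    ring
  unfold Phi0
  rw [hdet, Real.sqrt_mul (sq_nonneg _), Real.sqrt_sq hrho.le, mul_div_cancel_left₀ _ hrho.ne']

/-- r-derivatives -/
def Fr (a b r c : ℝ) : ℝ :=
  -2 * (a + b) ^ 2 / r ^ 3 - 4 * Kf a b c (uf a b r c) / r ^ 5
    - 2 * (a + b) ^ 2 * tf a b c * uf a b r c ^ 2 / r ^ 3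
def Frr (a b r c : ℝ) : ℝ :=
  6 * (a + b) ^ 2 / r ^ 4 + 20 * Kf a b c (uf a b r c) / r ^ 6
    + 14 * (a + b) ^ 2 * tf a b c * uf a b r c ^ 2 / r ^ 4
    + 8 * (a + b) ^ 2 * tf a b c * uf a b r c ^ 3 / r ^ 2

lemma uf_deriv_r {a b c r : ℝ} (h : 0 < r ^ 2 + wf a b c) :
    HasDerivAt (fun s => uf a b s c) (-2 * r * uf a b r c ^ 2) r := by
  have := ((hasDerivAt_pow 2 r).add_const (wf a b c)).inv h.ne'
  unfold uf
  refine this.congr_deriv ?_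
  field_simp
  push_cast
  ring

lemma K_deriv_r {a b c r : ℝ} (h : 0 < r ^ 2 + wf a b c) :
    HasDerivAt (fun s => Kf a b c (uf a b s c))
      ((a + b) ^ 2 * (tf a b c * (-2 * r * uf a b r c ^ 2))) r := by
  exact ((((uf_deriv_r h).const_mul (tf a b c)).const_add _).const_mul _).const_add _

lemma F_deriv_r {a b c r : ℝ} (hr : 0 < r) (h : 0 < r ^ 2 + wf a b c) :
    HasDerivAt (fun s => FF a b s c) (Fr a b r c) r := by
  have h1 := ((hasDerivAt_const r ((a + b) ^ 2)).div (hasDerivAt_pow 2 r)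
    (by positivity)).const_add 1
  have h2 := (K_deriv_r h).div (hasDerivAt_pow 4 r) (by positivity)
  refine (h1.add h2).congr_deriv ?_
  unfold Fr
  push_cast
  field_simp
  ring

lemma Fr_deriv_r {a b c r : ℝ} (hr : 0 < r) (h : 0 < r ^ 2 + wf a b c) :
    HasDerivAt (fun s => Fr a b s c) (Frr a b r c) r := by
  have h1 := (hasDerivAt_const r (-2 * (a + b) ^ 2)).div (hasDerivAt_pow 3 r) (by positivity)
  have h2 := ((K_deriv_r h).const_mul 4).div (hasDerivAt_pow 5 r) (by positivity)
  have h3 := (((uf_deriv_r h).pow 2).const_mul (2 * (a + b) ^ 2 * tf a b c)).div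
    (hasDerivAt_pow 3 r) (by positivity)
  refine ((h1.sub h2).sub h3).congr_deriv ?_
  unfold Frr
  simp only [Pi.pow_apply]
  push_cast
  field_simp
  ring

/-- c-derivatives -/
lemma wf_deriv (a b c : ℝ) : HasDerivAt (wf a b) (a ^ 2 - b ^ 2) c := by
  have := ((hasDerivAt_id c).const_mul (a ^ 2 - b ^ 2)).const_add (a * b + b ^ 2)
  exact this.congr_deriv (by ring)

lemma qf_deriv (a b c : ℝ) : HasDerivAt (qf a b) (b ^ 2 - a ^ 2) c := by
  have := (((hasDerivAt_id c).const_sub 1).const_mul (a ^ 2)).add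
    ((hasDerivAt_id c).const_mul (b ^ 2))
  exact this.congr_deriv (by ring)

lemma pf_deriv (a b c : ℝ) : HasDerivAt (pf a b) (a * b * (a + b) * (b - a)) c := by
  have := ((((hasDerivAt_id c).const_sub 1).const_mul a).add
    ((hasDerivAt_id c).const_mul b)).const_mul (a * b * (a + b))
  exact this.congr_deriv (by ring)

lemma tf_deriv (a b c : ℝ) : HasDerivAt (tf a b) (tf1 a b c) c := by
  have := (pf_deriv a b c).sub ((qf_deriv a b c).mul (wf_deriv a b c))
  exact this.congr_deriv (by unfold tf1; ring)

lemma tf1_deriv (a b c : ℝ) : HasDerivAt (tf1 a b) (tf2 a b) c := by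
  have := (((wf_deriv a b c).const_mul (b ^ 2 - a ^ 2)).const_sub
    (a * b * (a + b) * (b - a))).sub ((qf_deriv a b c).mul_const (a ^ 2 - b ^ 2))
  exact this.congr_deriv (by unfold tf2; ring)

lemma uf_deriv_c {a b c r : ℝ} (h : 0 < r ^ 2 + wf a b c) :
    HasDerivAt (fun c => uf a b r c) (-(a ^ 2 - b ^ 2) * uf a b r c ^ 2) c := by
  have := ((wf_deriv a b c).const_add (r ^ 2)).inv h.ne'
  refine this.congr_deriv ?_
  unfold uf
  field_simp

lemma H_deriv_c {a b c r : ℝ} (h : 0 < r ^ 2 + wf a b c) :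
    HasDerivAt (fun c => Hf a b c (uf a b r c)) (Hc a b c (uf a b r c)) c := by
  have := (qf_deriv a b c).add ((tf_deriv a b c).mul (uf_deriv_c h))
  exact this.congr_deriv (by unfold Hc; ring)

lemma Hc_deriv_c {a b c r : ℝ} (h : 0 < r ^ 2 + wf a b c) :
    HasDerivAt (fun c => Hc a b c (uf a b r c)) (Hcc a b c (uf a b r c)) c := by
  have := (((tf1_deriv a b c).mul (uf_deriv_c h)).const_add (b ^ 2 - a ^ 2)).sub
    (((tf_deriv a b c).mul_const (a ^ 2 - b ^ 2)).mul ((uf_deriv_c h).pow 2))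
  refine this.congr_deriv ?_
  unfold Hcc
  simp only [Pi.pow_apply]
  push_cast
  ring

lemma FF_deriv_c {a b c r : ℝ} (h : 0 < r ^ 2 + wf a b c) :
    HasDerivAt (fun c => FF a b r c) ((a + b) ^ 2 * Hc a b c (uf a b r c) / r ^ 4) c := by
  exact ((((H_deriv_c h).const_mul ((a + b) ^ 2)).const_add
    (a * b * (a + b) ^ 2)).div_const (r ^ 4)).const_add (1 + (a + b) ^ 2 / r ^ 2)

def Ft (a b r θ : ℝ) : ℝ :=
  (a + b) ^ 2 * Hc a b (Real.cos θ ^ 2) (uf a b r (Real.cos θ ^ 2)) / r ^ 4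
    * (-2 * Real.sin θ * Real.cos θ)
def Ftt (a b r θ : ℝ) : ℝ :=
  (a + b) ^ 2 / r ^ 4 *
    (4 * Real.sin θ ^ 2 * Real.cos θ ^ 2 * Hcc a b (Real.cos θ ^ 2) (uf a b r (Real.cos θ ^ 2))
      - 2 * (Real.cos θ ^ 2 - Real.sin θ ^ 2)
        * Hc a b (Real.cos θ ^ 2) (uf a b r (Real.cos θ ^ 2)))

lemma cossq_deriv (θ : ℝ) :
    HasDerivAt (fun t => Real.cos t ^ 2) (-2 * Real.sin θ * Real.cos θ) θ := by
  refine ((Real.hasDerivAt_cos θ).pow 2).congr_deriv ?_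
  push_cast
  ring

lemma F_deriv_t {a b r : ℝ} (θ : ℝ) (ha : 0 < a) (hb : 0 < b) :
    HasDerivAt (fun t => FF a b r (Real.cos t ^ 2)) (Ft a b r θ) θ := by
  have h := S_pos r ha hb (sq_nonneg (Real.cos θ)) (Real.cos_sq_le_one θ)
  exact HasDerivAt.comp (h₂ := fun c => FF a b r c) (h := fun t => Real.cos t ^ 2) θ
    (FF_deriv_c h) (cossq_deriv θ)

lemma Ft_deriv_t {a b r : ℝ} (θ : ℝ) (ha : 0 < a) (hb : 0 < b) :
    HasDerivAt (fun t => Ft a b r t) (Ftt a b r θ) θ := by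
  have h := S_pos r ha hb (sq_nonneg (Real.cos θ)) (Real.cos_sq_le_one θ)
  have h1 := (HasDerivAt.comp (h₂ := fun c => Hc a b c (uf a b r c))
    (h := fun t => Real.cos t ^ 2) θ (Hc_deriv_c h) (cossq_deriv θ)).const_mul ((a + b) ^ 2)
  have h2 := (h1.div_const (r ^ 4)).mul
    (((Real.hasDerivAt_sin θ).const_mul (-2)).mul (Real.hasDerivAt_cos θ))
  refine h2.congr_deriv ?_
  unfold Ftt
  simp only [Function.comp]
  simp only [Pi.mul_apply]
  ring

/-- `r⁶ ΔF` as a polynomial in `c, u, v`. -/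
def PP (a b c u v : ℝ) : ℝ :=
  8 * Kf a b c u + 8 * (a + b) ^ 2 * tf a b c * u * v + 8 * (a + b) ^ 2 * tf a b c * u * v ^ 2
    + (a + b) ^ 2 * (4 * (1 - 2 * c) * Hc a b c u + 4 * c * (1 - c) * Hcc a b c u)

def MM (a b c u v : ℝ) : ℝ := 4 * Kf a b c u + 2 * (a + b) ^ 2 * tf a b c * u * v

def NN (a b c u v : ℝ) : ℝ :=
  2 * MM a b c u v ^ 2 + 4 * (a + b) ^ 4 * c * (1 - c) * Hc a b c u ^ 2

lemma bdd (U : ℝ) (f : ℝ → ℝ → ℝ → ℝ)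
    (hf : Continuous fun p : ℝ × ℝ × ℝ => f p.1 p.2.1 p.2.2) :
    ∃ C : ℝ, 0 < C ∧ ∀ c ∈ Set.Icc (0 : ℝ) 1, ∀ u ∈ Set.Icc 0 U, ∀ v ∈ Set.Icc (0 : ℝ) 1,
      |f c u v| ≤ C := by
  obtain ⟨C, hC⟩ := ((isCompact_Icc (a := (0 : ℝ)) (b := 1)).prod
    ((isCompact_Icc (a := (0 : ℝ)) (b := U)).prod
      (isCompact_Icc (a := (0 : ℝ)) (b := 1)))).exists_bound_of_continuousOn hf.continuousOn
  refine ⟨max C 1, by positivity, fun c hc u hu v hv => ?_⟩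
  exact le_trans (hC (c, u, v) ⟨hc, hu, hv⟩) (le_max_left _ _)

lemma PP_cont (a b : ℝ) : Continuous fun p : ℝ × ℝ × ℝ => PP a b p.1 p.2.1 p.2.2 := by
  unfold PP Kf Hcc Hc Hf tf2 tf1 tf pf wf qf
  fun_prop

lemma NN_cont (a b : ℝ) : Continuous fun p : ℝ × ℝ × ℝ => NN a b p.1 p.2.1 p.2.2 := by
  unfold NN MM Kf Hc Hf tf1 tf pf wf qf
  fun_prop

end MPaux

open MP in
/-- Bound on the flat Laplacian of the extreme Myers–Perry conformal factor:
`|Δ₄Φ₀| ≤ C r⁻⁶` for a constant `C > 0` depending only on `a` and `b`. -/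
theorem Delta4_Phi0_bound (a b : ℝ) (ha : 0 < a) (hb : 0 < b) :
    ∃ C : ℝ, 0 < C ∧
      ∀ r θ : ℝ, 0 < r → θ ∈ Set.Ioo 0 (Real.pi / 2) →
        |Delta4 (Phi0 a b) r θ| ≤ C / r ^ 6 := by
  obtain ⟨C1, hC1, hP⟩ := MPaux.bdd (1 / (a * b)) (MPaux.PP a b) (MPaux.PP_cont a b)
  obtain ⟨C2, hC2, hN⟩ := MPaux.bdd (1 / (a * b)) (MPaux.NN a b) (MPaux.NN_cont a b)
  set k := a * b * (a + b) ^ 2 with hk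
  have hkpos : 0 < k := by positivity
  refine ⟨C1 + (8 * (a + b) ^ 4 + C2 / k), by positivity, fun r θ hr hθ => ?_⟩
  have hs : 0 < Real.sin θ := Real.sin_pos_of_pos_of_lt_pi hθ.1 (by linarith [hθ.2, Real.pi_pos])
  have hcs : 0 < Real.cos θ := Real.cos_pos_of_mem_Ioo ⟨by linarith [hθ.1, Real.pi_pos], hθ.2⟩
  have hc0 := sq_nonneg (Real.cos θ)
  have hc1 := Real.cos_sq_le_one θ
  have hS := MPaux.S_pos r ha hb hc0 hc1
  -- radial derivatives
  obtain ⟨R1, R2⟩ := MPaux.quarter_deriv (fun s => Phi0 a b s θ)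
    (fun s => MPaux.FF a b s (Real.cos θ ^ 2)) (fun s => MPaux.Fr a b s (Real.cos θ ^ 2))
    (MPaux.Frr a b r (Real.cos θ ^ 2)) r
    (by filter_upwards [lt_mem_nhds hr] with s hs using MPaux.Phi0_eq ha hb hs hθ)
    (by filter_upwards with s using lt_of_lt_of_le one_pos (MPaux.FF_ge s ha hb hc0 hc1))
    (by filter_upwards [lt_mem_nhds hr] with s hs using
          MPaux.F_deriv_r hs (MPaux.S_pos s ha hb hc0 hc1))
    (MPaux.Fr_deriv_r hr hS)
  obtain ⟨T1, T2⟩ := MPaux.quarter_deriv (fun t => Phi0 a b r t)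
    (fun t => MPaux.FF a b r (Real.cos t ^ 2)) (fun t => MPaux.Ft a b r t)
    (MPaux.Ftt a b r θ) θ
    (by filter_upwards [isOpen_Ioo.mem_nhds hθ] with t ht using MPaux.Phi0_eq ha hb hr ht)
    (by filter_upwards with t using lt_of_lt_of_le one_pos
          (MPaux.FF_ge r ha hb (sq_nonneg _) (Real.cos_sq_le_one t)))
    (by filter_upwards with t using MPaux.F_deriv_t t ha hb)
    (MPaux.Ft_deriv_t θ ha hb)
  have R2' : pdr (pdr (Phi0 a b)) r θ = _ := R2
  have T2' : pdt (pdt (Phi0 a b)) r θ = _ := T2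
  have R1' : pdr (Phi0 a b) r θ = _ := R1
  have T1' : pdt (Phi0 a b) r θ = _ := T1
  unfold Delta4
  rw [R2', T2', R1', T1']
  clear R2' T2' R1' T1' R1 R2 T1 T2
  have hF1 := MPaux.FF_ge r ha hb hc0 hc1
  have hK := MPaux.Kf_ge r ha hb hc0 hc1
  have hsc : Real.sin θ ^ 2 = 1 - Real.cos θ ^ 2 := Real.sin_sq θ
  have hw := MPaux.wf_pos ha hb hc0 hc1
  have hab := mul_pos ha hb
  set c := Real.cos θ ^ 2 with hcdef
  set u := MPaux.uf a b r c with hu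
  set F := MPaux.FF a b r c with hF
  have hu0 : 0 < u := inv_pos.2 hS
  have huU : u ≤ 1 / (a * b) := by
    rw [hu, MPaux.uf, inv_eq_one_div]
    exact one_div_le_one_div_of_le hab (by nlinarith [sq_nonneg r])
  have hv1 : r ^ 2 * u ≤ 1 := by
    rw [hu, MPaux.uf, ← div_eq_mul_inv, div_le_one hS]
    linarith
  have hv0 : 0 ≤ r ^ 2 * u := by positivity
  have bP := hP c ⟨hc0, hc1⟩ u ⟨hu0.le, huU⟩ (r ^ 2 * u) ⟨hv0, hv1⟩
  have bN := hN c ⟨hc0, hc1⟩ u ⟨hu0.le, huU⟩ (r ^ 2 * u) ⟨hv0, hv1⟩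
  have hFpos : 0 < F := by linarith
  have hX : F ^ (-(3 / 4) : ℝ) ≤ 1 := Real.rpow_le_one_of_one_le_of_nonpos hF1 (by norm_num)
  have hX0 : 0 < F ^ (-(3 / 4) : ℝ) := Real.rpow_pos_of_pos hFpos _
  set X := F ^ (-(3 / 4) : ℝ) with hXdef
  have hr4F : r ^ 4 * F = r ^ 4 + (a + b) ^ 2 * r ^ 2 + MPaux.Kf a b c u := by
    rw [hF, MPaux.FF, ← hu]
    field_simp
  set G := (2 * (a + b) ^ 2 * r ^ 2 + MPaux.MM a b c u (r ^ 2 * u)) ^ 2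
    + 4 * (a + b) ^ 4 * c * (1 - c) * MPaux.Hc a b c u ^ 2 with hG
  have hlap : MPaux.Frr a b r c + 3 / r * MPaux.Fr a b r c + (MPaux.Ftt a b r θ +
      (Real.cos θ / Real.sin θ - Real.sin θ / Real.cos θ) * MPaux.Ft a b r θ) / r ^ 2
      = MPaux.PP a b c u (r ^ 2 * u) / r ^ 6 := by
    have ht : (Real.cos θ / Real.sin θ - Real.sin θ / Real.cos θ) * MPaux.Ft a b r θ
        = (a + b) ^ 2 / r ^ 4 * (2 * (1 - 2 * c) * MPaux.Hc a b c u) := by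
      unfold MPaux.Ft
      rw [← hcdef, ← hu]
      have : (1 - 2 * c) = Real.sin θ ^ 2 - Real.cos θ ^ 2 := by rw [hsc]; ring
      rw [this]
      field_simp
      ring
    rw [ht]
    unfold MPaux.Ftt MPaux.Frr MPaux.Fr MPaux.PP
    rw [← hcdef, ← hu, hsc]
    field_simp
    ring
  have hgrad : MPaux.Fr a b r c ^ 2 / F + MPaux.Ft a b r θ ^ 2 / F / r ^ 2
      = G / (r ^ 4 * F) / r ^ 6 := by
    have ht : MPaux.Ft a b r θ ^ 2 =
        4 * (a + b) ^ 4 * c * (1 - c) * MPaux.Hc a b c u ^ 2 / r ^ 8 := by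
      unfold MPaux.Ft
      rw [← hcdef, ← hu, ← hsc, hcdef]
      field_simp
      ring
    have hfr : MPaux.Fr a b r c =
        -(2 * (a + b) ^ 2 * r ^ 2 + MPaux.MM a b c u (r ^ 2 * u)) / r ^ 5 := by
      unfold MPaux.Fr MPaux.MM
      rw [← hu]
      field_simp
      ring
    rw [ht, hfr, hG]
    field_simp
  have hG0 : 0 ≤ G := by
    have : 0 ≤ 1 - c := by linarith
    positivity
  have hGle : G / (r ^ 4 * F) ≤ 8 * (a + b) ^ 4 + C2 / k := by
    rw [div_le_iff₀ (by positivity), hr4F]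
    have e1 : G ≤ 8 * (a + b) ^ 4 * r ^ 4 + MPaux.NN a b c u (r ^ 2 * u) := by
      rw [hG, MPaux.NN]
      nlinarith [sq_nonneg (2 * (a + b) ^ 2 * r ^ 2 - MPaux.MM a b c u (r ^ 2 * u))]
    have e2 := le_trans (le_abs_self _) bN
    have e3 : C2 = C2 / k * k := by field_simp
    have e4 : 0 < C2 / k := by positivity
    have e5 : 0 ≤ (a + b) ^ 2 * r ^ 2 := by positivity
    have e6 : 0 ≤ (a + b) ^ 4 := by positivity
    have e7 : C2 / k * k ≤ C2 / k * (r ^ 4 + (a + b) ^ 2 * r ^ 2 + MPaux.Kf a b c u) := by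
      apply mul_le_mul_of_nonneg_left _ e4.le
      have : 0 ≤ r ^ 4 := by positivity
      linarith
    have e8 : 8 * (a + b) ^ 4 * r ^ 4 ≤
        8 * (a + b) ^ 4 * (r ^ 4 + (a + b) ^ 2 * r ^ 2 + MPaux.Kf a b c u) := by
      apply mul_le_mul_of_nonneg_left _ (by positivity)
      linarith
    linarith
  have hmain : 1 / 4 * X * (MPaux.Frr a b r c - 3 / 4 * (MPaux.Fr a b r c ^ 2 / F)) +
      3 / r * (1 / 4 * X * MPaux.Fr a b r c) +
      (1 / 4 * X * (MPaux.Ftt a b r θ - 3 / 4 * (MPaux.Ft a b r θ ^ 2 / F)) +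
        (Real.cos θ / Real.sin θ - Real.sin θ / Real.cos θ) *
          (1 / 4 * X * MPaux.Ft a b r θ)) / r ^ 2
      = X / 4 * (MPaux.PP a b c u (r ^ 2 * u) - 3 / 4 * (G / (r ^ 4 * F))) / r ^ 6 := by
    have : X / 4 * (MPaux.PP a b c u (r ^ 2 * u) - 3 / 4 * (G / (r ^ 4 * F))) / r ^ 6
      = X / 4 * (MPaux.PP a b c u (r ^ 2 * u) / r ^ 6 - 3 / 4 * (G / (r ^ 4 * F) / r ^ 6)) := by
      ring
    rw [this, ← hlap, ← hgrad]
    ring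
  refine le_of_eq_of_le (congrArg abs hmain) ?_
  rw [abs_div, abs_of_pos (show 0 < r ^ 6 by positivity)]
  apply div_le_div_of_nonneg_right _ (by positivity)
  have hg0 : 0 ≤ G / (r ^ 4 * F) := by positivity
  rw [abs_mul, abs_of_pos (show 0 < X / 4 by positivity)]
  have h1 : |MPaux.PP a b c u (r ^ 2 * u) - 3 / 4 * (G / (r ^ 4 * F))|
      ≤ C1 + (8 * (a + b) ^ 4 + C2 / k) := by
    rw [abs_le] at bP ⊢
    constructor <;> linarith [bP.1, bP.2]
  calc _ ≤ 1 * |MPaux.PP a b c u (r ^ 2 * u) - 3 / 4 * (G / (r ^ 4 * F))| :=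
        mul_le_mul_of_nonneg_right (by linarith) (abs_nonneg _)
    _ ≤ _ := by linarith

end
end
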